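/- arXiv:2206.14671 — 11 statements merged into one kernel-verified Lean document; each statement's English description precedes it below -/
import Mathlib

section
/- Let η₀ > 0 and k ∈ ℕ. There exists a constant C > 0, depending only on ψ, k, and η₀, such that for all 0 < η ≤ η₀ and all s ∈ ℝ, the complex number c_{s,η} satisfies |c_{s,η}| ≤ C / ((|s| + 1)(|ηs|^k + 1)). -/
open MeasureTheory Real

lemma integral_deriv_mul_cexp {f : ℝ → ℂ} (hf : ContDiff ℝ 1 f) (hc : HasCompactSupport f)
    (z : ℂ) :
    ∫ u : ℝ, deriv f u * Complex.exp (u * z) = -z * ∫ u : ℝ, f u * Complex.exp (u * z) := by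
  have hexp : ∀ u : ℝ, HasDerivAt (fun u : ℝ => Complex.exp (u * z))
      (Complex.exp (u * z) * z) u := fun u => by
    simpa using ((Complex.ofRealCLM.hasDerivAt (x := u)).mul_const z).cexp
  have hfd : ∀ u, HasDerivAt f (deriv f u) u := fun u =>
    (hf.differentiable one_ne_zero u).hasDerivAt
  have hf0 : Continuous f := hf.continuous
  have hf' : Continuous (deriv f) := hf.continuous_deriv le_rfl
  have h := integral_mul_deriv_eq_deriv_mul_of_integrable
    (fun u _ => hfd u) (fun u _ => hexp u)
    (Continuous.integrable_of_hasCompactSupport (by fun_prop) hc.mul_right)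
    (Continuous.integrable_of_hasCompactSupport (by fun_prop) hc.deriv.mul_right)
    (Continuous.integrable_of_hasCompactSupport (by fun_prop) hc.mul_right)
  rw [← neg_eq_iff_eq_neg.mpr h, ← integral_const_mul, ← integral_neg]
  congr 1 with u
  ring

lemma norm_integral_mul_cexp_le {f : ℝ → ℂ} (hf : Continuous f)
    (hs : tsupport f ⊆ Set.Icc (-1) 1) (z : ℂ) :
    ‖∫ u : ℝ, f u * Complex.exp (u * z)‖ ≤ (∫ u, ‖f u‖) * Real.exp |z.re| := by
  have hc : HasCompactSupport f := isCompact_Icc.of_isClosed_subset (isClosed_tsupport f) hs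
  rw [← integral_mul_const]
  refine norm_integral_le_of_norm_le
    ((hf.integrable_of_hasCompactSupport hc).norm.mul_const _) (.of_forall fun u => ?_)
  by_cases hu : u ∈ tsupport f
  · rw [norm_mul, Complex.norm_exp, Complex.re_ofReal_mul]
    gcongr
    calc u * z.re ≤ |u| * |z.re| := (le_abs_self _).trans (abs_mul _ _).le
      _ ≤ |z.re| := mul_le_of_le_one_left (abs_nonneg _) (abs_le.mpr (hs hu))
  · simp [image_eq_zero_of_notMem_tsupport hu]

/-- Polynomial decay of the Fourier–Laplace transform of a smooth function supported
in `[-1,1]`. -/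
lemma exists_pow_mul_norm_integral_mul_cexp_le (k : ℕ) {f : ℝ → ℂ}
    (hf : ContDiff ℝ (⊤ : ℕ∞) f) (hs : tsupport f ⊆ Set.Icc (-1) 1) :
    ∃ A : ℝ, 0 ≤ A ∧ ∀ z : ℂ,
      ‖z‖ ^ k * ‖∫ u : ℝ, f u * Complex.exp (u * z)‖ ≤ A * Real.exp |z.re| := by
  induction k generalizing f with
  | zero =>
    exact ⟨∫ u, ‖f u‖, by positivity, fun z => by
      simpa using norm_integral_mul_cexp_le hf.continuous hs z⟩
  | succ k ih =>
    have hc : HasCompactSupport f := isCompact_Icc.of_isClosed_subset (isClosed_tsupport f) hs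
    obtain ⟨A, hA, h⟩ := ih (f := deriv f) (contDiff_infty_iff_deriv.mp hf).2
      ((closure_minimal support_deriv_subset (isClosed_tsupport f)).trans hs)
    refine ⟨A, hA, fun z => ?_⟩
    have hz := h z
    rw [integral_deriv_mul_cexp (hf.of_le (by exact_mod_cast le_top)) hc, norm_mul, norm_neg,
      ← mul_assoc, ← pow_succ] at hz
    exact hz

lemma integral_rescale_mul_cexp (ψ : ℝ → ℝ) {η : ℝ} (hη : 0 < η) (w : ℂ) :
    ∫ t : ℝ, (((1 / η) * ψ (t / η) : ℝ) : ℂ) * Complex.exp (t * w) =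
      ∫ u : ℝ, (ψ u : ℂ) * Complex.exp (u * (η * w)) := by
  have h := Measure.integral_comp_div
    (fun u : ℝ => (ψ u : ℂ) * Complex.exp (u * (η * w))) η
  have hη' : (η : ℂ) ≠ 0 := by exact_mod_cast hη.ne'
  rw [abs_of_pos hη, ← inv_smul_eq_iff₀ hη.ne', ← integral_smul] at h
  rw [← h]
  congr 1 with t
  rw [Complex.real_smul]
  push_cast
  rw [show (t : ℂ) / η * (η * w) = t * w by field_simp]
  ring

/-- For a fixed smooth, even, non-negative bump function `ψ` supported in
`[-1,1]` with integral one, for every `η₀ > 0` and `k ∈ ℕ` there is a constant `C > 0`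
(depending only on `ψ`, `k`, `η₀`) such that for all `0 < η ≤ η₀` and all real `s`,
`|c_{s,η}| ≤ C / ((|s| + 1) (|ηs|^k + 1))`, where
`c_{s,η} = ∫ ψ_η(t) e^{t(1+is)}/(1+is) dt` and `ψ_η(t) = (1/η) ψ(t/η)`. -/
theorem stmt_0 (ψ : ℝ → ℝ) (hψ_smooth : ContDiff ℝ (⊤ : ℕ∞) ψ)
    (hψ_even : ∀ t, ψ (-t) = ψ t) (hψ_nonneg : ∀ t, 0 ≤ ψ t)
    (hψ_supp : Function.support ψ ⊆ Set.Icc (-1) 1)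
    (hψ_int : ∫ t, ψ t = 1)
    (η₀ : ℝ) (hη₀ : 0 < η₀) (k : ℕ) :
    ∃ C : ℝ, 0 < C ∧ ∀ η : ℝ, 0 < η → η ≤ η₀ → ∀ s : ℝ,
      ‖∫ t : ℝ, (((1 / η) * ψ (t / η) : ℝ) : ℂ) *
          Complex.exp ((t : ℂ) * (1 + Complex.I * (s : ℂ))) / (1 + Complex.I * (s : ℂ))‖
        ≤ C / ((|s| + 1) * (|η * s| ^ k + 1)) := by
  have hf : ContDiff ℝ (⊤ : ℕ∞) (fun u => (ψ u : ℂ)) :=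
    Complex.ofRealCLM.contDiff.comp hψ_smooth
  have hs : tsupport (fun u => (ψ u : ℂ)) ⊆ Set.Icc (-1) 1 :=
    closure_minimal (fun u hu => hψ_supp (by simpa using hu)) isClosed_Icc
  obtain ⟨A, hA, hAz⟩ := exists_pow_mul_norm_integral_mul_cexp_le 0 hf hs
  obtain ⟨B, hB, hBz⟩ := exists_pow_mul_norm_integral_mul_cexp_le k hf hs
  refine ⟨2 * ((A + B + 1) * Real.exp η₀), by positivity, fun η hη hηη₀ s => ?_⟩
  rw [integral_div, integral_rescale_mul_cexp ψ hη, norm_div]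
  set w : ℂ := 1 + Complex.I * s
  have hre : w.re = 1 := by simp [w]
  have him : w.im = s := by simp [w]
  have hw1 : 1 ≤ ‖w‖ := by simpa [hre] using Complex.abs_re_le_norm w
  have hws : |s| ≤ ‖w‖ := by simpa [him] using Complex.abs_im_le_norm w
  have hηs : |η * s| ≤ ‖(η : ℂ) * w‖ := by
    simpa [him] using Complex.abs_im_le_norm ((η : ℂ) * w)
  have hexp : Real.exp |((η : ℂ) * w).re| ≤ Real.exp η₀ := by
    simpa [hre, abs_of_pos hη] using hηη₀
  have h0 := hAz (η * w)
  have hk := hBz (η * w)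
  set J := ‖∫ u : ℝ, (ψ u : ℂ) * Complex.exp (u * (η * w))‖
  have hJ : 0 ≤ J := norm_nonneg _
  have hbound : J * (|η * s| ^ k + 1) ≤ (A + B + 1) * Real.exp η₀ := calc
    J * (|η * s| ^ k + 1) ≤ J * (‖(η : ℂ) * w‖ ^ k + 1) := by gcongr
    _ = ‖(η : ℂ) * w‖ ^ k * J + ‖(η : ℂ) * w‖ ^ 0 * J := by ring
    _ ≤ B * Real.exp η₀ + A * Real.exp η₀ :=
      add_le_add (hk.trans (by gcongr)) (h0.trans (by gcongr))
    _ ≤ (A + B + 1) * Real.exp η₀ := by linarith [Real.exp_pos η₀]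
  rw [div_le_div_iff₀ (by linarith) (by positivity)]
  calc J * ((|s| + 1) * (|η * s| ^ k + 1)) = (|s| + 1) * (J * (|η * s| ^ k + 1)) := by ring
    _ ≤ (2 * ‖w‖) * ((A + B + 1) * Real.exp η₀) :=
      mul_le_mul (by linarith) hbound (by positivity) (by positivity)
    _ = 2 * ((A + B + 1) * Real.exp η₀) * ‖w‖ := by ring
end

section
/- For all y > 0, η > 0, and s ∈ ℝ, one has ∫_ℝ g_{y,η}(x) (e^x + e^{−x}) e^{isx} dx = 2 e^y Re(e^{isy} c_{s,η}) − 2 e^{−y} Re(e^{−isy} c_{s,η}). -/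
open MeasureTheory Real

/-- The bilateral Laplace transform of a convolution of real functions is the product of the
transforms. -/
theorem laplace_convolution (k h : ℝ → ℝ) (z : ℂ)
    (hk : Integrable fun t : ℝ => (k t : ℂ) * Complex.exp (z * t))
    (hh : Integrable fun t : ℝ => (h t : ℂ) * Complex.exp (z * t)) :
    Integrable (fun x : ℝ => ((∫ t, k t * h (x - t) : ℝ) : ℂ) * Complex.exp (z * x)) ∧
      ∫ x : ℝ, ((∫ t, k t * h (x - t) : ℝ) : ℂ) * Complex.exp (z * x) =
        (∫ t : ℝ, (k t : ℂ) * Complex.exp (z * t)) *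
          ∫ t : ℝ, (h t : ℂ) * Complex.exp (z * t) := by
  have key : (fun x : ℝ => ((∫ t, k t * h (x - t) : ℝ) : ℂ) * Complex.exp (z * x)) =
      convolution (fun t : ℝ => (k t : ℂ) * Complex.exp (z * t))
        (fun t : ℝ => (h t : ℂ) * Complex.exp (z * t)) (ContinuousLinearMap.mul ℝ ℂ) volume := by
    funext x
    rw [convolution, ← integral_complex_ofReal, ← integral_mul_const]
    congr 1
    funext t
    have hexp : Complex.exp (z * x) =
        Complex.exp (z * t) * Complex.exp (z * ((x - t : ℝ) : ℂ)) := by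
      rw [← Complex.exp_add]
      congr 1
      push_cast
      ring
    rw [hexp, ContinuousLinearMap.mul_apply']
    push_cast
    ring
  rw [key]
  exact ⟨hk.integrable_convolution _ hh, integral_convolution _ hk hh⟩

/-- The Laplace transform of the indicator function of `[-y, y]`. -/
theorem laplace_indicator_Icc (y : ℝ) (hy : 0 ≤ y) (z : ℂ) (hz : z ≠ 0) :
    Integrable (fun t : ℝ =>
        ((Set.indicator (Set.Icc (-y) y) (fun _ => (1 : ℝ)) t : ℝ) : ℂ) * Complex.exp (z * t)) ∧
      ∫ t : ℝ, ((Set.indicator (Set.Icc (-y) y) (fun _ => (1 : ℝ)) t : ℝ) : ℂ) *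
          Complex.exp (z * t) =
        (Complex.exp (z * y) - Complex.exp (-(z * y))) / z := by
  have key : (fun t : ℝ => ((Set.indicator (Set.Icc (-y) y) (fun _ => (1 : ℝ)) t : ℝ) : ℂ) *
      Complex.exp (z * t)) =
      Set.indicator (Set.Icc (-y) y) fun t : ℝ => Complex.exp (z * t) := by
    funext t
    by_cases ht : t ∈ Set.Icc (-y) y <;> simp only [Set.indicator, ht] <;> simp
  rw [key]
  refine ⟨?_, ?_⟩
  · rw [integrable_indicator_iff measurableSet_Icc]
    exact Continuous.integrableOn_Icc (by fun_prop)
  · rw [integral_indicator measurableSet_Icc, integral_Icc_eq_integral_Ioc,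
      ← intervalIntegral.integral_of_le (by linarith), integral_exp_mul_complex hz]
    push_cast
    rw [mul_neg]

/-- For all `y > 0`, `η > 0`, `s ∈ ℝ`,
`∫ g_{y,η}(x) (e^x + e^{-x}) e^{isx} dx = 2 e^y Re(e^{isy} c_{s,η}) - 2 e^{-y} Re(e^{-isy} c_{s,η})`,
where `g_{y,η} = ψ_η ⋆ χ_{[-y,y]}` and `c_{s,η} = ∫ ψ_η(t) e^{t(1+is)}/(1+is) dt`. -/
theorem stmt_1 (ψ : ℝ → ℝ) (hψ_smooth : ContDiff ℝ (⊤ : ℕ∞) ψ)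
    (hψ_even : ∀ t, ψ (-t) = ψ t) (hψ_nonneg : ∀ t, 0 ≤ ψ t)
    (hψ_supp : Function.support ψ ⊆ Set.Icc (-1) 1)
    (hψ_int : ∫ t, ψ t = 1)
    (y η s : ℝ) (hy : 0 < y) (hη : 0 < η)
    (g : ℝ → ℝ)
    (hg : ∀ x, g x = ∫ t : ℝ,
      (1 / η) * ψ (t / η) * Set.indicator (Set.Icc (-y) y) (fun _ => (1 : ℝ)) (x - t))
    (c : ℂ)
    (hc : c = ∫ t : ℝ, (((1 / η) * ψ (t / η) : ℝ) : ℂ) *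
      Complex.exp ((t : ℂ) * (1 + Complex.I * (s : ℂ))) / (1 + Complex.I * (s : ℂ))) :
    (∫ x : ℝ, ((g x : ℝ) : ℂ) * ((Real.exp x + Real.exp (-x) : ℝ) : ℂ) *
        Complex.exp (Complex.I * (s : ℂ) * (x : ℂ)))
      = ((2 * Real.exp y * (Complex.exp (Complex.I * (s : ℂ) * (y : ℂ)) * c).re
          - 2 * Real.exp (-y) * (Complex.exp (-(Complex.I * (s : ℂ) * (y : ℂ))) * c).re : ℝ) : ℂ) := by
  set w : ℂ := 1 + Complex.I * s with hw
  have hw0 : w ≠ 0 := fun h => by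
    have := congrArg Complex.re h
    simp [hw] at this
  have hwc : (starRingEnd ℂ) w = 1 - Complex.I * s := by simp [hw, sub_eq_add_neg]
  have hwc0 : (starRingEnd ℂ) w ≠ 0 := by simpa using hw0
  have hψ_cont := hψ_smooth.continuous
  set k : ℝ → ℝ := fun t => (1 / η) * ψ (t / η) with hk
  have hk_cont : Continuous k := by fun_prop
  have hk_even : ∀ t, k (-t) = k t := fun t => by simp only [hk, neg_div, hψ_even]
  have hk_supp : HasCompactSupport k := by
    refine HasCompactSupport.intro (isCompact_Icc (a := -η) (b := η)) fun t ht => ?_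
    have : ψ (t / η) = 0 := by
      by_contra h
      have h1 := hψ_supp (Function.mem_support.2 h)
      rw [Set.mem_Icc, le_div_iff₀ hη, div_le_iff₀ hη] at h1
      exact ht ⟨by linarith, by linarith⟩
    simp [hk, this]
  have hk_int (z : ℂ) : Integrable fun t : ℝ => (k t : ℂ) * Complex.exp (z * t) := by
    refine Continuous.integrable_of_hasCompactSupport (by fun_prop) ?_
    exact (hk_supp.comp_left (g := ((↑) : ℝ → ℂ)) Complex.ofReal_zero).mul_right
  set K : ℂ → ℂ := fun z => ∫ t : ℝ, (k t : ℂ) * Complex.exp (z * t) with hK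
  have hK_neg (z : ℂ) : K (-z) = K z := by
    simp only [hK]
    rw [← integral_neg_eq_self]
    simp [hk_even]
  have hK_conj (z : ℂ) : K ((starRingEnd ℂ) z) = (starRingEnd ℂ) (K z) := by
    simp only [hK]
    rw [← integral_conj]
    simp [← Complex.exp_conj]
  have hcK : c = K w / w := by
    rw [hc]
    simp only [hK]
    rw [← integral_div]
    simp only [mul_comm w, hk]
  have transform (z : ℂ) (hz : z ≠ 0) :
      Integrable (fun x : ℝ => (g x : ℂ) * Complex.exp (z * x)) ∧
        ∫ x : ℝ, (g x : ℂ) * Complex.exp (z * x) =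
          K z * ((Complex.exp (z * y) - Complex.exp (-(z * y))) / z) := by
    obtain ⟨hi, he⟩ := laplace_indicator_Icc y hy.le z hz
    have := laplace_convolution k _ z (hk_int z) hi
    rw [he] at this
    simpa only [hg] using this
  obtain ⟨hi₁, he₁⟩ := transform w hw0
  obtain ⟨hi₂, he₂⟩ := transform (-(starRingEnd ℂ) w) (neg_ne_zero.2 hwc0)
  have hsplit (x : ℝ) : (g x : ℂ) * ((Real.exp x + Real.exp (-x) : ℝ) : ℂ) *
      Complex.exp (Complex.I * s * x) =
      (g x : ℂ) * Complex.exp (w * x) + (g x : ℂ) * Complex.exp (-(starRingEnd ℂ) w * x) := by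
    have h₁ : w * x = x + Complex.I * s * x := by rw [hw]; ring
    have h₂ : -(starRingEnd ℂ) w * x = -x + Complex.I * s * x := by rw [hwc]; ring
    rw [h₁, h₂, Complex.exp_add, Complex.exp_add]
    push_cast
    ring
  have hre (u : ℝ) (a : ℂ) : ((2 * Real.exp u * (Complex.exp a * c).re : ℝ) : ℂ) =
      Complex.exp (u + a) * c + (starRingEnd ℂ) (Complex.exp (u + a) * c) := by
    rw [Complex.add_conj, Complex.exp_add, mul_assoc (Complex.exp u), ← Complex.ofReal_exp,
      Complex.re_ofReal_mul]
    push_cast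
    ring
  simp only [hsplit]
  rw [integral_add hi₁ hi₂, he₁, he₂, Complex.ofReal_sub, hre, hre, hK_neg, hK_conj]
  have h₁ : (y : ℂ) + Complex.I * s * y = w * y := by rw [hw]; ring
  have h₂ : ((-y : ℝ) : ℂ) + -(Complex.I * s * y) = -(w * y) := by rw [hw]; push_cast; ring
  rw [h₁, h₂, hcK]
  simp only [map_mul, map_div₀, ← Complex.exp_conj, map_neg, Complex.conj_ofReal, neg_mul, neg_neg]
  field_simp
  ring
end

section
/- For all y > 0, η > 0, and s ∈ ℝ, one has ∫_ℝ h_{y,η}(x) (e^x + e^{−x}) e^{isx} dx = (e^{y(1+is)} + e^{−y(1+is)} − 2) c_{s,η} − (e^{y(−1+is)} + e^{−y(−1+is)} − 2) · conj(c_{s,η}), where conj denotes complex conjugation. -/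
open MeasureTheory Real

/-- The two-sided sign cutoff times a function is a difference of two indicators. -/
lemma sign_cutoff_mul_eq (y : ℝ) (hy : 0 < y) (φ : ℝ → ℂ) (u : ℝ) :
    ((Set.indicator (Set.Icc (-y) y) (fun _ => (1 : ℝ)) u * Real.sign u : ℝ) : ℂ) * φ u
      = (Set.Icc 0 y).indicator φ u - (Set.Icc (-y) 0).indicator φ u := by
  rcases lt_trichotomy u 0 with hu | rfl | hu
  · rw [Real.sign_of_neg hu]
    by_cases h1 : -y ≤ u
    · simp [Set.indicator, h1, hu.le, not_le.2 hu, (hu.trans hy).le]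
    · simp [Set.indicator, h1, not_le.2 hu]
  · simp [Set.indicator, hy.le]
  · rw [Real.sign_of_pos hu]
    by_cases h1 : u ≤ y
    · simp [Set.indicator, h1, hu.le, not_le.2 hu, (show -y ≤ u by linarith)]
    · simp [Set.indicator, h1, not_le.2 hu]

lemma integrable_sign_cutoff_mul {y : ℝ} (hy : 0 < y) {φ : ℝ → ℂ} (hφ : Continuous φ) :
    Integrable (fun u : ℝ =>
      ((Set.indicator (Set.Icc (-y) y) (fun _ => (1 : ℝ)) u * Real.sign u : ℝ) : ℂ) * φ u) := by
  simp_rw [sign_cutoff_mul_eq y hy φ]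
  exact (hφ.integrableOn_Icc.integrable_indicator measurableSet_Icc).sub
    (hφ.integrableOn_Icc.integrable_indicator measurableSet_Icc)

lemma integral_sign_cutoff_mul_exp {y : ℝ} (hy : 0 < y) {w : ℂ} (hw : w ≠ 0) :
    (∫ u : ℝ, ((Set.indicator (Set.Icc (-y) y) (fun _ => (1 : ℝ)) u * Real.sign u : ℝ) : ℂ)
      * Complex.exp (w * u))
      = (Complex.exp (y * w) + Complex.exp (-y * w) - 2) / w := by
  have hφ : Continuous fun u : ℝ => Complex.exp (w * u) := by fun_prop
  simp_rw [sign_cutoff_mul_eq y hy fun u : ℝ => Complex.exp (w * u)]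
  rw [integral_sub (hφ.integrableOn_Icc.integrable_indicator measurableSet_Icc)
    (hφ.integrableOn_Icc.integrable_indicator measurableSet_Icc),
    integral_indicator measurableSet_Icc, integral_indicator measurableSet_Icc,
    integral_Icc_eq_integral_Ioc, integral_Icc_eq_integral_Ioc,
    ← intervalIntegral.integral_of_le hy.le,
    ← intervalIntegral.integral_of_le (by linarith : -y ≤ 0),
    integral_exp_mul_complex hw, integral_exp_mul_complex hw]
  simp only [Complex.ofReal_zero, zero_mul, Complex.exp_zero, Complex.ofReal_neg, mul_comm w]
  ring

/-- The exponential moments of a convolution with the sign cutoff are integrable and factor. -/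
lemma convolution_sign_cutoff_exp_moment {k : ℝ → ℝ} (hk : Continuous k)
    (hks : HasCompactSupport k) {y : ℝ} (hy : 0 < y) {h : ℝ → ℝ}
    (hh : ∀ x, h x = ∫ t : ℝ, k t *
      (Set.indicator (Set.Icc (-y) y) (fun _ => (1 : ℝ)) (x - t) * Real.sign (x - t)))
    {w : ℂ} (hw : w ≠ 0) :
    Integrable (fun x : ℝ => (h x : ℂ) * Complex.exp (w * x)) ∧
    ∫ x : ℝ, (h x : ℂ) * Complex.exp (w * x)
      = (Complex.exp (y * w) + Complex.exp (-y * w) - 2) *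
        ∫ t : ℝ, (k t : ℂ) * Complex.exp (t * w) / w := by
  have hφ : Continuous fun u : ℝ => Complex.exp (w * u) := by fun_prop
  have hF : Integrable fun t : ℝ => (k t : ℂ) * Complex.exp (w * t) := by
    refine Continuous.integrable_of_hasCompactSupport (by fun_prop) ?_
    exact (hks.comp_left (g := fun r : ℝ => (r : ℂ)) Complex.ofReal_zero).mul_right
  have hG := integrable_sign_cutoff_mul hy hφ
  have key : (fun x : ℝ => (h x : ℂ) * Complex.exp (w * x)) =
      convolution (fun t : ℝ => (k t : ℂ) * Complex.exp (w * t)) (fun u : ℝ =>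
        ((Set.indicator (Set.Icc (-y) y) (fun _ => (1 : ℝ)) u * Real.sign u : ℝ) : ℂ)
          * Complex.exp (w * u)) (ContinuousLinearMap.mul ℝ ℂ) volume := by
    funext x
    rw [hh, ← integral_complex_ofReal, ← integral_mul_const, convolution_def]
    congr 1
    funext t
    have he : Complex.exp (w * x) = Complex.exp (w * t) * Complex.exp (w * (x - t : ℝ)) := by
      rw [← Complex.exp_add]; push_cast; ring_nf
    rw [he, ContinuousLinearMap.mul_apply', Complex.ofReal_mul]
    ring
  refine ⟨key ▸ hF.integrable_convolution _ hG, ?_⟩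
  rw [key, integral_convolution _ hF hG, ContinuousLinearMap.mul_apply',
    integral_sign_cutoff_mul_exp hy hw, integral_div]
  simp only [mul_comm w]
  ring

/-- For all `y > 0`, `η > 0`, `s ∈ ℝ`,
`∫ h_{y,η}(x) (e^x + e^{-x}) e^{isx} dx
  = (e^{y(1+is)} + e^{-y(1+is)} - 2) c_{s,η} - (e^{y(-1+is)} + e^{-y(-1+is)} - 2) conj(c_{s,η})`,
where `h_{y,η} = ψ_η ⋆ (χ_{[-y,y]} · sgn)` and `c_{s,η} = ∫ ψ_η(t) e^{t(1+is)}/(1+is) dt`. -/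
theorem stmt_2 (ψ : ℝ → ℝ) (hψ_smooth : ContDiff ℝ (⊤ : ℕ∞) ψ)
    (hψ_even : ∀ t, ψ (-t) = ψ t) (hψ_nonneg : ∀ t, 0 ≤ ψ t)
    (hψ_supp : Function.support ψ ⊆ Set.Icc (-1) 1)
    (hψ_int : ∫ t, ψ t = 1)
    (y η s : ℝ) (hy : 0 < y) (hη : 0 < η)
    (h : ℝ → ℝ)
    (hh : ∀ x, h x = ∫ t : ℝ,
      (1 / η) * ψ (t / η) *
        (Set.indicator (Set.Icc (-y) y) (fun _ => (1 : ℝ)) (x - t) * Real.sign (x - t)))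
    (c : ℂ)
    (hc : c = ∫ t : ℝ, (((1 / η) * ψ (t / η) : ℝ) : ℂ) *
      Complex.exp ((t : ℂ) * (1 + Complex.I * (s : ℂ))) / (1 + Complex.I * (s : ℂ))) :
    (∫ x : ℝ, ((h x : ℝ) : ℂ) * ((Real.exp x + Real.exp (-x) : ℝ) : ℂ) *
        Complex.exp (Complex.I * (s : ℂ) * (x : ℂ)))
      = (Complex.exp ((y : ℂ) * (1 + Complex.I * (s : ℂ)))
          + Complex.exp ((-y : ℂ) * (1 + Complex.I * (s : ℂ))) - 2) * c
        - (Complex.exp ((y : ℂ) * (-1 + Complex.I * (s : ℂ)))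
          + Complex.exp ((-y : ℂ) * (-1 + Complex.I * (s : ℂ))) - 2) * (starRingEnd ℂ) c := by
  have hks : HasCompactSupport fun t : ℝ => (1 / η) * ψ (t / η) := by
    refine HasCompactSupport.intro (isCompact_Icc (a := -η) (b := η)) fun t ht => ?_
    have : ψ (t / η) = 0 := by
      by_contra hne
      obtain ⟨h1, h2⟩ := hψ_supp hne
      rw [le_div_iff₀ hη] at h1
      rw [div_le_iff₀ hη] at h2
      exact ht ⟨by linarith, by linarith⟩
    simp [this]
  have hψ_cont := hψ_smooth.continuous
  have hk : Continuous fun t : ℝ => (1 / η) * ψ (t / η) := by fun_prop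
  have hw₁ : (1 + Complex.I * (s : ℂ)) ≠ 0 := fun h0 => by
    simpa using congrArg Complex.re h0
  have hw₂ : (-1 + Complex.I * (s : ℂ)) ≠ 0 := fun h0 => by
    simpa using congrArg Complex.re h0
  obtain ⟨hi₁, he₁⟩ := convolution_sign_cutoff_exp_moment hk hks hy hh hw₁
  obtain ⟨hi₂, he₂⟩ := convolution_sign_cutoff_exp_moment hk hks hy hh hw₂
  have hconj : ∫ t : ℝ, (((1 / η) * ψ (t / η) : ℝ) : ℂ) *
      Complex.exp ((t : ℂ) * (-1 + Complex.I * (s : ℂ))) / (-1 + Complex.I * (s : ℂ))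
      = -(starRingEnd ℂ) c := by
    rw [hc, ← integral_conj, ← integral_neg, ← integral_neg_eq_self]
    congr 1
    funext t
    rw [neg_div, hψ_even]
    simp only [map_div₀, map_mul, ← Complex.exp_conj, map_add, map_one, Complex.conj_I,
      Complex.conj_ofReal]
    rw [← div_neg]
    push_cast
    ring_nf
  have hsplit : ∀ x : ℝ, ((h x : ℝ) : ℂ) * ((Real.exp x + Real.exp (-x) : ℝ) : ℂ) *
        Complex.exp (Complex.I * (s : ℂ) * (x : ℂ))
      = (h x : ℂ) * Complex.exp ((1 + Complex.I * (s : ℂ)) * x)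
        + (h x : ℂ) * Complex.exp ((-1 + Complex.I * (s : ℂ)) * x) := fun x => by
    rw [add_mul, add_mul, Complex.exp_add, Complex.exp_add]
    push_cast
    rw [one_mul, neg_one_mul]
    ring
  simp_rw [hsplit]
  rw [integral_add hi₁ hi₂, he₁, he₂, hconj, ← hc]
  ring
end

section
/- Let n ≥ 1, let s₁, …, sₙ be nonzero real numbers, a₁, …, aₙ ∈ ℂ, b ∈ ℝ, and y₀ ≥ 0. Let A be the topological closure in the torus 𝕋ⁿ = ℝⁿ/ℤⁿ of the subgroup {(s₁y/(2π), …, sₙy/(2π)) mod ℤⁿ : y ∈ ℝ}; A is a compact subgroup of 𝕋ⁿ, carrying its Haar probability measure μ_A. Define w : 𝕋ⁿ → ℝ by w(x₁, …, xₙ) = 2 ∑_{j=1}^n Re(a_j e^{2πi x_j}) + b. Then for every continuous function h : ℝ → ℂ, the limit lim_{Y→∞} (1/Y) ∫_{y₀}^Y h(2 ∑_{j=1}^n Re(a_j e^{i s_j y}) + b) dy exists and equals ∫_A h(w(x)) dμ_A(x), which in turn equals ∫_ℝ h dμ, where μ := w_* μ_A is the pushforward of μ_A under w, a Borel probability measure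 on ℝ. -/
open MeasureTheory Real

open Filter Topology

/-- Non-constant exponentials have mean zero along the half-line. -/
theorem tendsto_average_cexp {c : ℝ} (hc : c ≠ 0) (y₀ : ℝ) :
    Tendsto (fun Y : ℝ => (1 / Y : ℝ) • ∫ y in y₀..Y, Complex.exp (Complex.I * c * y))
      atTop (𝓝 0) := by
  have hc' : Complex.I * (c : ℂ) ≠ 0 := by simp [hc]
  have hnorm : ∀ y : ℝ, ‖Complex.exp (Complex.I * c * y)‖ = 1 := fun y => by
    rw [mul_assoc, mul_comm, ← Complex.ofReal_mul]
    exact Complex.norm_exp_ofReal_mul_I _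
  have hbound : ∀ Y : ℝ, ‖∫ y in y₀..Y, Complex.exp (Complex.I * c * y)‖ ≤ 2 / |c| := by
    intro Y
    rw [integral_exp_mul_complex hc', norm_div]
    have hden : ‖Complex.I * (c : ℂ)‖ = |c| := by simp
    rw [hden]
    gcongr
    refine (norm_sub_le _ _).trans ?_
    rw [hnorm, hnorm]
    norm_num
  have hinv : Tendsto (fun Y : ℝ => 1 / Y) atTop (𝓝 0) := by
    simpa using tendsto_inv_atTop_zero (𝕜 := ℝ)
  exact hinv.zero_smul_isBoundedUnder_le
    (isBoundedUnder_of ⟨2 / |c|, hbound⟩)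

/-- The mean value of a constant along the half-line is that constant. -/
theorem tendsto_average_const (z : ℂ) (y₀ : ℝ) :
    Tendsto (fun Y : ℝ => (1 / Y : ℝ) • ∫ _ in y₀..Y, z) atTop (𝓝 z) := by
  have hlim : Tendsto (fun Y : ℝ => (1 - y₀ * Y⁻¹) • z) atTop (𝓝 z) := by
    simpa using ((tendsto_inv_atTop_zero (𝕜 := ℝ)).const_mul y₀).const_sub 1 |>.smul_const z
  refine hlim.congr' ?_
  filter_upwards [eventually_gt_atTop 0] with Y hY
  rw [intervalIntegral.integral_const, smul_smul]
  congr 1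
  field_simp

/-- **Weyl's criterion** for curves: it suffices to test equidistribution on a set of continuous
functions with dense span. -/
theorem tendsto_average_of_dense_span {X : Type*} [TopologicalSpace X] [CompactSpace X]
    [MeasurableSpace X] [BorelSpace X] (ν : Measure X) [IsProbabilityMeasure ν]
    {γ : ℝ → X} (hγ : Continuous γ) {y₀ : ℝ} (hy₀ : 0 ≤ y₀) {S : Set C(X, ℂ)}
    (hS : (Submodule.span ℂ S).topologicalClosure = ⊤)
    (hlim : ∀ f ∈ S, Tendsto (fun Y : ℝ => (1 / Y : ℝ) • ∫ y in y₀..Y, f (γ y))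
      atTop (𝓝 (∫ x, f x ∂ν)))
    (f : C(X, ℂ)) :
    Tendsto (fun Y : ℝ => (1 / Y : ℝ) • ∫ y in y₀..Y, f (γ y)) atTop (𝓝 (∫ x, f x ∂ν)) := by
  have hint : ∀ g : C(X, ℂ), Integrable g ν := fun g =>
    g.continuous.integrable_of_hasCompactSupport (HasCompactSupport.of_compactSpace _)
  have hii : ∀ (g : C(X, ℂ)) (u v : ℝ), IntervalIntegrable (fun y => g (γ y)) volume u v :=
    fun g u v => (g.continuous.comp hγ).intervalIntegrable u v
  have hspan : ∀ g ∈ Submodule.span ℂ S,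
      Tendsto (fun Y : ℝ => (1 / Y : ℝ) • ∫ y in y₀..Y, g (γ y)) atTop (𝓝 (∫ x, g x ∂ν)) := by
    intro g hg
    induction hg using Submodule.span_induction with
    | mem g hg => exact hlim g hg
    | zero => simp
    | add g₁ g₂ _ _ h₁ h₂ =>
      simp only [ContinuousMap.add_apply]
      rw [integral_add (hint g₁) (hint g₂)]
      refine (h₁.add h₂).congr fun Y => ?_
      rw [intervalIntegral.integral_add (hii g₁ _ _) (hii g₂ _ _), smul_add]
    | smul c g _ h =>
      simp only [ContinuousMap.smul_apply]
      rw [integral_smul]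
      refine (h.const_smul c).congr fun Y => ?_
      rw [intervalIntegral.integral_smul, smul_comm]
  have hf : f ∈ closure (Submodule.span ℂ S : Set C(X, ℂ)) := by
    rw [← Submodule.topologicalClosure_coe, hS]
    trivial
  rw [Metric.tendsto_nhds]
  intro ε hε
  obtain ⟨g, hg, hfg⟩ := Metric.mem_closure_iff.1 hf (ε / 3) (by positivity)
  have hsub : ∀ x, ‖f x - g x‖ ≤ ε / 3 := fun x => by
    rw [← dist_eq_norm]
    exact (ContinuousMap.dist_apply_le_dist x).trans hfg.le
  have hνsub : dist (∫ x, g x ∂ν) (∫ x, f x ∂ν) ≤ ε / 3 := by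
    rw [dist_comm, dist_eq_norm, ← integral_sub (hint f) (hint g)]
    simpa using norm_integral_le_of_norm_le_const (μ := ν) (Eventually.of_forall hsub)
  filter_upwards [Metric.tendsto_nhds.1 (hspan g hg) (ε / 3) (by positivity),
    eventually_gt_atTop 0, eventually_ge_atTop y₀] with Y hY hY0 hYy₀
  have havg : dist ((1 / Y : ℝ) • ∫ y in y₀..Y, f (γ y))
      ((1 / Y : ℝ) • ∫ y in y₀..Y, g (γ y)) ≤ ε / 3 := by
    rw [dist_eq_norm, ← smul_sub, ← intervalIntegral.integral_sub (hii f _ _) (hii g _ _),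
      norm_smul, Real.norm_of_nonneg (by positivity)]
    have hle := intervalIntegral.norm_integral_le_of_norm_le_const (a := y₀) (b := Y)
      (f := fun y => f (γ y) - g (γ y)) (C := ε / 3) fun y _ => hsub (γ y)
    rw [abs_of_nonneg (sub_nonneg.2 hYy₀)] at hle
    calc 1 / Y * ‖∫ y in y₀..Y, (f (γ y) - g (γ y))‖
        ≤ 1 / Y * (ε / 3 * (Y - y₀)) := by gcongr
      _ ≤ 1 / Y * (ε / 3 * Y) := by gcongr; linarith
      _ = ε / 3 := by field_simp
  linarith [dist_triangle4 ((1 / Y : ℝ) • ∫ y in y₀..Y, f (γ y))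
    ((1 / Y : ℝ) • ∫ y in y₀..Y, g (γ y)) (∫ x, g x ∂ν) (∫ x, f x ∂ν)]

/-- The characters of the torus are multiplicative in the point. -/
theorem mFourier_add_apply {d : Type*} [Fintype d] (k : d → ℤ) (x y : UnitAddTorus d) :
    UnitAddTorus.mFourier k (x + y) = UnitAddTorus.mFourier k x * UnitAddTorus.mFourier k y := by
  simp [UnitAddTorus.mFourier, fourier_apply, smul_add, AddCircle.toCircle_add,
    Finset.prod_mul_distrib]

/-- The characters of the torus restrict to exponentials on one-parameter subgroups. -/
theorem mFourier_line {d : Type*} [Fintype d] (k : d → ℤ) (s : d → ℝ) (y : ℝ) :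
    UnitAddTorus.mFourier k (fun j => ((s j * y / (2 * π) : ℝ) : AddCircle (1 : ℝ))) =
      Complex.exp (Complex.I * (∑ j, k j * s j : ℝ) * y) := by
  simp only [UnitAddTorus.mFourier, ContinuousMap.coe_mk, fourier_coe_apply]
  rw [← Complex.exp_sum]
  congr 1
  push_cast
  rw [Finset.mul_sum, Finset.sum_mul]
  refine Finset.sum_congr rfl fun j _ => ?_
  have hpi : (π : ℂ) ≠ 0 := Complex.ofReal_ne_zero.2 pi_ne_zero
  field_simp

/-- **Kronecker–Weyl theorem**: a one-parameter subgroup of a torus equidistributes in its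
closure. -/
theorem tendsto_average_line {d : Type*} [Fintype d] (s : d → ℝ) {y₀ : ℝ} (hy₀ : 0 ≤ y₀)
    (A : AddSubgroup (UnitAddTorus d))
    (hA : (A : Set (UnitAddTorus d)) =
      closure (Set.range fun y : ℝ => fun j => ((s j * y / (2 * π) : ℝ) : AddCircle (1 : ℝ))))
    (μ : Measure A) [IsProbabilityMeasure μ] (hinv : ∀ g : A, μ.map (fun x => g + x) = μ)
    (f : C(UnitAddTorus d, ℂ)) :
    Tendsto (fun Y : ℝ => (1 / Y : ℝ) •
        ∫ y in y₀..Y, f (fun j => ((s j * y / (2 * π) : ℝ) : AddCircle (1 : ℝ))))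
      atTop (𝓝 (∫ x : A, f x ∂μ)) := by
  set γ : ℝ → UnitAddTorus d := fun y j => ((s j * y / (2 * π) : ℝ) : AddCircle (1 : ℝ)) with hγdef
  have hγ : Continuous γ := continuous_pi fun j =>
    (AddCircle.continuous_mk' 1).comp (by fun_prop)
  have hmap : ∀ g : C(UnitAddTorus d, ℂ),
      ∫ x, g x ∂(μ.map (Subtype.val : A → UnitAddTorus d)) = ∫ x : A, g x ∂μ := fun g =>
    integral_map measurable_subtype_coe.aemeasurable g.continuous.aestronglyMeasurable
  have : IsProbabilityMeasure (μ.map (Subtype.val : A → UnitAddTorus d)) :=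
    Measure.isProbabilityMeasure_map measurable_subtype_coe.aemeasurable
  rw [← hmap f]
  refine tendsto_average_of_dense_span _ hγ hy₀
    UnitAddTorus.span_mFourier_closure_eq_top ?_ f
  rintro _ ⟨k, rfl⟩
  rw [hmap]
  have hline : ∀ y, UnitAddTorus.mFourier k (γ y) = _ := mFourier_line k s
  have hmem : ∀ y, γ y ∈ A := fun y => by
    rw [← SetLike.mem_coe, hA]
    exact subset_closure ⟨y, rfl⟩
  by_cases hc : (∑ j, k j * s j : ℝ) = 0
  · have hone : ∀ x ∈ closure (Set.range γ), UnitAddTorus.mFourier k x = 1 := by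
      refine fun x hx => closure_minimal (t := {x | UnitAddTorus.mFourier k x = 1}) ?_
        (isClosed_eq (UnitAddTorus.mFourier k).continuous continuous_const) hx
      rintro _ ⟨y, rfl⟩
      rw [Set.mem_ofPred_eq, hline, hc]
      simp
    have hμ : ∫ x : A, UnitAddTorus.mFourier k x ∂μ = 1 := by
      rw [integral_congr_ae (Eventually.of_forall fun x : A => hone x (hA ▸ x.2))]
      simp
    rw [hμ]
    refine (tendsto_average_const 1 y₀).congr fun Y => ?_
    congr 2
    ext y
    exact (hone _ (subset_closure ⟨y, rfl⟩)).symm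
  · have hμ : ∫ x : A, UnitAddTorus.mFourier k x ∂μ = 0 := by
      let g : A := ⟨γ (π / ∑ j, k j * s j), hmem _⟩
      have hg : UnitAddTorus.mFourier k (g : UnitAddTorus d) = -1 := by
        have := hline (π / ∑ j, k j * s j)
        rw [mul_assoc, ← Complex.ofReal_mul, mul_div_cancel₀ _ hc, mul_comm,
          Complex.exp_pi_mul_I] at this
        exact this
      have hshift : ∫ x : A, UnitAddTorus.mFourier k x ∂μ =
          ∫ x : A, UnitAddTorus.mFourier k ((g + x : A) : UnitAddTorus d) ∂μ := by
        conv_lhs => rw [← hinv g]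
        refine integral_map (by fun_prop) ?_
        exact ((UnitAddTorus.mFourier k).continuous.comp
          continuous_subtype_val).aestronglyMeasurable
      simp only [AddSubgroup.coe_add, mFourier_add_apply, hg, integral_const_mul] at hshift
      linear_combination hshift / 2
    rw [hμ]
    simpa only [hline] using tendsto_average_cexp hc y₀

/-- Kronecker–Weyl sampling. Let `s₁,…,sₙ` be nonzero reals, `a₁,…,aₙ ∈ ℂ`,
`b ∈ ℝ`, `y₀ ≥ 0`. Let `A` be the closure in `𝕋ⁿ = (ℝ/ℤ)ⁿ` of
`{(s₁y/2π, …, sₙy/2π) : y ∈ ℝ}`, with its Haar (translation-invariant) probability measure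
`μA`, and let `w(x) = 2 ∑ⱼ Re(aⱼ e^{2πi xⱼ}) + b`. Then for every continuous `h : ℝ → ℂ`,
`(1/Y) ∫_{y₀}^Y h(2 ∑ⱼ Re(aⱼ e^{i sⱼ y}) + b) dy` converges as `Y → ∞` to
`∫_A h(w(x)) dμA`, which equals `∫_ℝ h dμ` for the pushforward probability measure
`μ = w_* μA` on `ℝ`. -/
theorem stmt_5 (n : ℕ) (hn : 1 ≤ n) (s : Fin n → ℝ) (hs : ∀ j, s j ≠ 0)
    (a : Fin n → ℂ) (b : ℝ) (y₀ : ℝ) (hy₀ : 0 ≤ y₀)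
    (A : AddSubgroup (Fin n → AddCircle (1 : ℝ)))
    (hA : (A : Set (Fin n → AddCircle (1 : ℝ))) =
      closure (Set.range fun y : ℝ => fun j : Fin n =>
        ((s j * y / (2 * Real.pi) : ℝ) : AddCircle (1 : ℝ))))
    (μA : Measure A) (hμA : IsProbabilityMeasure μA)
    (hinv : ∀ g : A, μA.map (fun x => g + x) = μA)
    (w : (Fin n → AddCircle (1 : ℝ)) → ℝ)
    (hw : ∀ x, w x = 2 * ∑ j, (a j * ((AddCircle.toCircle (x j) : Circle) : ℂ)).re + b)
    (h : ℝ → ℂ) (hh : Continuous h) :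
    Filter.Tendsto (fun Y : ℝ => (1 / Y : ℝ) • ∫ y in y₀..Y,
        h (2 * ∑ j, (a j * Complex.exp (Complex.I * (s j : ℂ) * (y : ℂ))).re + b))
      Filter.atTop (nhds (∫ x : A, h (w x) ∂μA)) ∧
    (∫ x : A, h (w x) ∂μA) = (∫ z : ℝ, h z ∂(μA.map (fun x : A => w x))) ∧
    IsProbabilityMeasure (μA.map (fun x : A => w x)) := by
  have hwc : Continuous w := by
    rw [funext hw]
    fun_prop
  have hwA : Measurable fun x : A => w x := (hwc.comp continuous_subtype_val).measurable
  refine ⟨?_, ?_, Measure.isProbabilityMeasure_map hwA.aemeasurable⟩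
  · refine (tendsto_average_line s hy₀ A hA μA hinv ⟨fun x => h (w x), hh.comp hwc⟩).congr
      fun Y => ?_
    congr 2
    ext y
    simp only [ContinuousMap.coe_mk, hw]
    congr 4
    ext j
    rw [AddCircle.toCircle_apply_mk, Circle.coe_exp]
    congr 3
    have hpi : (π : ℂ) ≠ 0 := Complex.ofReal_ne_zero.2 pi_ne_zero
    push_cast
    field_simp
  · exact (integral_map hwA.aemeasurable hh.aestronglyMeasurable).symm
end

section
/- Let n ≥ 1, let s₁, …, sₙ be nonzero real numbers, a₁, …, aₙ ∈ ℂ, and b ∈ ℝ. Let A be the topological closure in the torus 𝕋ⁿ = ℝⁿ/ℤⁿ of the subgroup {(s₁y/(2π), …, sₙy/(2π)) mod ℤⁿ : y ∈ ℝ}, with Haar probability measure μ_A, let w : 𝕋ⁿ → ℝ be w(x₁, …, xₙ) = 2 ∑_{j=1}^n Re(a_j e^{2πi x_j}) + b, and let μ := w_* μ_A be the pushforward Borel probability measure on ℝ. Then (1) μ has mean b, i.e. ∫_ℝ x dμ(x) = b, and (2) μ is supported in the compact interval [b − 2 ∑_{j=1}^n |a_j|, b + 2 ∑_{j=1}^n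 |a_j|]. -/
open MeasureTheory Real

/-- A function which changes sign under some measure-preserving translation has integral zero. -/
theorem integral_eq_zero_of_map_add_left_of_neg {G E : Type*} [Add G] [MeasurableSpace G]
    [MeasurableAdd G] [NormedAddCommGroup E] [NormedSpace ℝ E] {μ : Measure G} {f : G → E} {g : G}
    (hf : AEStronglyMeasurable f μ) (hμ : μ.map (fun x => g + x) = μ)
    (hg : ∀ x, f (g + x) = -f x) : ∫ x, f x ∂μ = 0 := by
  have h : ∫ x, f (g + x) ∂μ = ∫ x, f x ∂μ := by
    rw [← integral_map (φ := fun x => g + x) (measurable_const_add g).aemeasurable (by rwa [hμ]), hμ]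
  simp_rw [hg, integral_neg] at h
  have := IsAddTorsionFree.of_isTorsionFree ℝ E
  exact self_eq_neg.mp h.symm

theorem AddCircle.toCircle_half : AddCircle.toCircle (((1 / 2 : ℝ)) : AddCircle (1 : ℝ)) = -1 := by
  rw [AddCircle.toCircle_apply_mk]
  ext
  rw [Circle.coe_exp, Circle.coe_neg, Circle.coe_one, ← Complex.exp_pi_mul_I]
  congr 2
  push_cast
  ring

/-- With `A` the closure in `𝕋ⁿ` of `{(s₁y/2π,…,sₙy/2π) : y ∈ ℝ}`,
`μA` its Haar probability measure, `w(x) = 2 ∑ⱼ Re(aⱼ e^{2πi xⱼ}) + b`, and `μ = w_* μA`: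
(1) `μ` has mean `b`, and (2) `μ` is supported in
`[b - 2 ∑ⱼ |aⱼ|, b + 2 ∑ⱼ |aⱼ|]`. -/
theorem stmt_6 (n : ℕ) (hn : 1 ≤ n) (s : Fin n → ℝ) (hs : ∀ j, s j ≠ 0)
    (a : Fin n → ℂ) (b : ℝ)
    (A : AddSubgroup (Fin n → AddCircle (1 : ℝ)))
    (hA : (A : Set (Fin n → AddCircle (1 : ℝ))) =
      closure (Set.range fun y : ℝ => fun j : Fin n =>
        ((s j * y / (2 * Real.pi) : ℝ) : AddCircle (1 : ℝ))))
    (μA : Measure A) (hμA : IsProbabilityMeasure μA)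
    (hinv : ∀ g : A, μA.map (fun x => g + x) = μA)
    (w : (Fin n → AddCircle (1 : ℝ)) → ℝ)
    (hw : ∀ x, w x = 2 * ∑ j, (a j * ((AddCircle.toCircle (x j) : Circle) : ℂ)).re + b) :
    (∫ x : ℝ, x ∂(μA.map (fun x : A => w x))) = b ∧
    (μA.map (fun x : A => w x))
      ((Set.Icc (b - 2 * ∑ j, ‖a j‖) (b + 2 * ∑ j, ‖a j‖))ᶜ) = 0 := by
  have hcont (j : Fin n) :
      Continuous fun x : A => (a j * (AddCircle.toCircle (x.1 j) : ℂ)).re :=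
    Complex.continuous_re.comp (continuous_const.mul (continuous_subtype_val.comp
      (AddCircle.continuous_toCircle.comp ((continuous_apply j).comp continuous_subtype_val))))
  have hbound (j : Fin n) (x : Fin n → AddCircle (1 : ℝ)) :
      |(a j * (AddCircle.toCircle (x j) : ℂ)).re| ≤ ‖a j‖ :=
    (Complex.abs_re_le_norm _).trans_eq (by rw [norm_mul, Circle.norm_coe, mul_one])
  have hint (j : Fin n) :
      Integrable (fun x : A => (a j * (AddCircle.toCircle (x.1 j) : ℂ)).re) μA :=
    .of_bound (hcont j).aestronglyMeasurable ‖a j‖ (.of_forall fun x => hbound j x)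
  have hzero (j : Fin n) : ∫ x : A, (a j * (AddCircle.toCircle (x.1 j) : ℂ)).re ∂μA = 0 := by
    let g : Fin n → AddCircle (1 : ℝ) :=
      fun i => ((s i * (π / s j) / (2 * π) : ℝ) : AddCircle (1 : ℝ))
    have hgA : g ∈ A := by
      rw [← SetLike.mem_coe, hA]
      exact subset_closure ⟨π / s j, rfl⟩
    have hgj : AddCircle.toCircle (g j) = -1 := by
      rw [← AddCircle.toCircle_half]
      have := hs j
      congr 1
      change ((_ : ℝ) : AddCircle (1 : ℝ)) = _
      congr 1
      field_simp
    refine integral_eq_zero_of_map_add_left_of_neg (hcont j).aestronglyMeasurable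
      (hinv ⟨g, hgA⟩) fun x => ?_
    simp [AddCircle.toCircle_add, hgj]
  have hwm : Measurable fun x : A => w x := by
    simp_rw [hw]
    exact (((continuous_finsetSum _ fun j _ => hcont j).const_mul 2).add continuous_const).measurable
  constructor
  · rw [integral_map hwm.aemeasurable continuous_id'.aestronglyMeasurable]
    simp_rw [hw]
    rw [integral_add ((integrable_finsetSum _ fun j _ => hint j).const_mul 2) (integrable_const b),
      integral_const_mul, integral_finsetSum _ fun j _ => hint j]
    simp_rw [hzero]
    simp
  · rw [Measure.map_apply hwm measurableSet_Icc.compl]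
    convert measure_empty (μ := μA)
    refine Set.eq_empty_of_forall_notMem fun x hx => hx ?_
    have h : |∑ j, (a j * (AddCircle.toCircle (x.1 j) : ℂ)).re| ≤ ∑ j, ‖a j‖ :=
      (Finset.abs_sum_le_sum_abs _ _).trans (Finset.sum_le_sum fun j _ => hbound j x)
    rw [abs_le] at h
    change w x ∈ _
    rw [hw]
    constructor <;> linarith
end

section
/- Let n ≥ 1, let s₁, …, sₙ be real numbers that are linearly independent over ℚ, let a₁, …, aₙ ∈ ℂ, b ∈ ℝ, and y₀ ≥ 0. Then for every continuous function h : ℝ → ℂ, lim_{Y→∞} (1/Y) ∫_{y₀}^Y h(2 ∑_{j=1}^n Re(a_j e^{i s_j y}) + b) dy = ∫_{[0,1]ⁿ} h(2 ∑_{j=1}^n Re(a_j e^{2πi x_j}) + b) dx₁ ⋯ dxₙ. -/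
open MeasureTheory Real

/-- The average of `f` over `[y₀, Y]`, normalised by `Y`. -/
noncomputable def timeAverage (f : ℝ → ℂ) (y₀ Y : ℝ) : ℂ := (1 / Y : ℝ) • ∫ y in y₀..Y, f y

/-- The exponential of a nonzero frequency has mean value zero. -/
theorem tendsto_timeAverage_exp {σ : ℝ} (hσ : σ ≠ 0) (y₀ : ℝ) :
    Filter.Tendsto (timeAverage (fun y : ℝ => Complex.exp (σ * Complex.I * y)) y₀)
      Filter.atTop (nhds 0) := by
  have hc : (σ * Complex.I : ℂ) ≠ 0 := by simp [hσ]
  have hexp (y : ℝ) : ‖Complex.exp (σ * Complex.I * y)‖ = 1 := by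
    rw [show (σ * Complex.I * y : ℂ) = ((σ * y : ℝ) : ℂ) * Complex.I by push_cast; ring]
    exact Complex.norm_exp_ofReal_mul_I _
  refine squeeze_zero_norm' (a := fun Y : ℝ => Y⁻¹ * (2 / |σ|)) ?_
    (by simpa using tendsto_inv_atTop_zero.mul_const (2 / |σ|))
  filter_upwards [Filter.eventually_gt_atTop (0 : ℝ)] with Y hY
  rw [timeAverage, integral_exp_mul_complex hc, norm_smul, one_div, norm_inv,
    Real.norm_of_nonneg hY.le, norm_div]
  gcongr
  · refine (norm_sub_le _ _).trans ?_
    rw [hexp, hexp]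
    norm_num
  · simp

/-- The mean value of a constant function is that constant. -/
theorem tendsto_timeAverage_one (y₀ : ℝ) :
    Filter.Tendsto (timeAverage (fun _ => 1) y₀) Filter.atTop (nhds 1) := by
  have h : Filter.Tendsto (fun Y : ℝ => ((1 - y₀ * Y⁻¹ : ℝ) : ℂ)) Filter.atTop (nhds 1) := by
    have := (tendsto_inv_atTop_zero (𝕜 := ℝ)).const_mul y₀ |>.const_sub 1
    simpa [Function.comp_def] using (Complex.continuous_ofReal.tendsto _).comp this
  refine h.congr' ?_
  filter_upwards [Filter.eventually_gt_atTop (0 : ℝ)] with Y hY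
  have hY' : (Y : ℂ) ≠ 0 := by exact_mod_cast hY.ne'
  simp only [timeAverage, intervalIntegral.integral_const, Complex.real_smul]
  push_cast
  field_simp

namespace UnitAddTorus

variable {d : Type*}

/-- The linear flow on the torus with angular velocities `s`. -/
noncomputable def linearFlow (s : d → ℝ) (y : ℝ) : UnitAddTorus d :=
  fun j => ((s j * y / (2 * π) : ℝ) : UnitAddCircle)

theorem continuous_linearFlow (s : d → ℝ) : Continuous (linearFlow s) :=
  continuous_pi fun j => (AddCircle.continuous_mk' 1).comp (by fun_prop)

theorem intervalIntegrable_linearFlow (s : d → ℝ) (F : C(UnitAddTorus d, ℂ)) (u v : ℝ) :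
    IntervalIntegrable (fun y => F (linearFlow s y)) volume u v :=
  (F.continuous.comp (continuous_linearFlow s)).intervalIntegrable u v

theorem norm_timeAverage_linearFlow_le (s : d → ℝ) (F : C(UnitAddTorus d, ℂ)) {y₀ Y : ℝ}
    (hy₀ : 0 ≤ y₀) (hY : y₀ < Y) :
    ‖timeAverage (fun y => F (linearFlow s y)) y₀ Y‖ ≤ ‖F‖ := by
  have hY0 : 0 < Y := hy₀.trans_lt hY
  have := intervalIntegral.norm_integral_le_of_norm_le_const (a := y₀) (b := Y)
    (f := fun y => F (linearFlow s y)) (C := ‖F‖) (fun y _ => F.norm_coe_le_norm _)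
  rw [abs_of_pos (sub_pos.mpr hY)] at this
  rw [timeAverage, norm_smul, one_div, norm_inv, Real.norm_of_nonneg hY0.le,
    inv_mul_le_iff₀ hY0, mul_comm Y]
  exact this.trans (by gcongr; linarith)

theorem timeAverage_linearFlow_sub (s : d → ℝ) (F G : C(UnitAddTorus d, ℂ)) (y₀ Y : ℝ) :
    timeAverage (fun y => (F - G) (linearFlow s y)) y₀ Y =
      timeAverage (fun y => F (linearFlow s y)) y₀ Y -
        timeAverage (fun y => G (linearFlow s y)) y₀ Y := by
  simp only [timeAverage, ContinuousMap.sub_apply]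
  rw [intervalIntegral.integral_sub (intervalIntegrable_linearFlow s F _ _)
    (intervalIntegrable_linearFlow s G _ _), smul_sub]

variable [Fintype d]

/-- The integral of a function on the torus, as an integral over the unit cube. -/
noncomputable def cubeIntegral (F : UnitAddTorus d → ℂ) : ℂ :=
  ∫ x in Set.Icc (0 : d → ℝ) 1, F (fun j => (x j : UnitAddCircle))

theorem mFourier_linearFlow (s : d → ℝ) (k : d → ℤ) (y : ℝ) :
    mFourier k (linearFlow s y) = Complex.exp ((∑ j, k j * s j : ℝ) * Complex.I * y) := by
  simp only [mFourier, linearFlow, ContinuousMap.coe_mk, fourier_coe_apply]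
  rw [← Complex.exp_sum]
  congr 1
  push_cast
  rw [Finset.sum_mul, Finset.sum_mul]
  refine Finset.sum_congr rfl fun j _ => ?_
  have : (π : ℂ) ≠ 0 := by exact_mod_cast pi_ne_zero
  field_simp

theorem integral_Icc_fourier (k : ℤ) :
    ∫ x in Set.Icc (0 : ℝ) 1, fourier k (x : UnitAddCircle) = if k = 0 then 1 else 0 := by
  rw [integral_Icc_eq_integral_Ioc, ← intervalIntegral.integral_of_le zero_le_one]
  split_ifs with hk
  · simp [hk]
  · have hc : (2 * π * Complex.I * k : ℂ) ≠ 0 := by simp [hk, pi_ne_zero]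
    simp only [fourier_coe_apply, Complex.ofReal_one, div_one]
    rw [integral_exp_mul_complex hc]
    have : Complex.exp (2 * π * Complex.I * k) = 1 :=
      Complex.exp_eq_one_iff.mpr ⟨k, by ring⟩
    simp [this]

theorem cubeIntegral_mFourier (k : d → ℤ) :
    cubeIntegral (mFourier k) = if k = 0 then 1 else 0 := by
  have hset : Set.Icc (0 : d → ℝ) 1 = Set.univ.pi fun _ => Set.Icc (0 : ℝ) 1 := by
    simp [Set.pi_univ_Icc, Pi.zero_def, Pi.one_def]
  simp only [cubeIntegral, mFourier, ContinuousMap.coe_mk]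
  rw [hset, volume_pi, Measure.restrict_pi_pi,
    integral_fintype_prod_eq_prod (fun j (x : ℝ) => fourier (k j) (x : UnitAddCircle))]
  simp only [integral_Icc_fourier]
  rw [Finset.prod_ite_zero]
  simp [funext_iff]

theorem integrableOn_cube (F : C(UnitAddTorus d, ℂ)) :
    IntegrableOn (fun x : d → ℝ => F (fun j => (x j : UnitAddCircle))) (Set.Icc 0 1) :=
  (F.continuous.comp (continuous_pi fun j =>
    (AddCircle.continuous_mk' 1).comp (continuous_apply j))).continuousOn.integrableOn_compact
      isCompact_Icc

theorem norm_cubeIntegral_le (F : C(UnitAddTorus d, ℂ)) : ‖cubeIntegral F‖ ≤ ‖F‖ := by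
  have hvol : volume (Set.Icc (0 : d → ℝ) 1) = 1 := by simp [Real.volume_Icc_pi]
  have := norm_setIntegral_le_of_norm_le_const (μ := volume) (s := Set.Icc (0 : d → ℝ) 1)
    (f := fun x => F (fun j => (x j : UnitAddCircle))) (C := ‖F‖) (by simp [hvol])
    (fun x _ => F.norm_coe_le_norm _)
  simpa [cubeIntegral, Measure.real, hvol] using this

theorem cubeIntegral_sub (F G : C(UnitAddTorus d, ℂ)) :
    cubeIntegral (F - G : C(UnitAddTorus d, ℂ)) = cubeIntegral F - cubeIntegral G := by
  simp only [cubeIntegral, ContinuousMap.sub_apply]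
  exact integral_sub (integrableOn_cube F) (integrableOn_cube G)

theorem tendsto_timeAverage_mFourier {s : d → ℝ} (hs : LinearIndependent ℚ s) (y₀ : ℝ)
    (k : d → ℤ) :
    Filter.Tendsto (timeAverage (fun y => mFourier k (linearFlow s y)) y₀) Filter.atTop
      (nhds (cubeIntegral (mFourier k))) := by
  rw [cubeIntegral_mFourier]
  simp only [mFourier_linearFlow]
  split_ifs with hk
  · simpa [hk] using tendsto_timeAverage_one y₀
  · refine tendsto_timeAverage_exp (fun h => hk ?_) y₀
    have := Fintype.linearIndependent_iff.mp hs (fun j => (k j : ℚ))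
      (by simpa [Rat.smul_def] using h)
    ext j
    exact_mod_cast this j

theorem tendsto_timeAverage_of_mem_span {s : d → ℝ} (hs : LinearIndependent ℚ s) (y₀ : ℝ)
    {F : C(UnitAddTorus d, ℂ)} (hF : F ∈ Submodule.span ℂ (Set.range (mFourier (d := d)))) :
    Filter.Tendsto (timeAverage (fun y => F (linearFlow s y)) y₀) Filter.atTop
      (nhds (cubeIntegral F)) := by
  induction hF using Submodule.span_induction with
  | mem F hF =>
    obtain ⟨k, rfl⟩ := hF
    exact tendsto_timeAverage_mFourier hs y₀ k
  | zero =>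
    refine tendsto_const_nhds.congr fun Y => ?_
    simp [timeAverage, cubeIntegral]
  | add F G _ _ hF hG =>
    convert! hF.add hG using 2 with Y
    · simp only [timeAverage, ContinuousMap.add_apply]
      rw [intervalIntegral.integral_add (intervalIntegrable_linearFlow s F _ _)
        (intervalIntegrable_linearFlow s G _ _), smul_add]
    · exact integral_add (integrableOn_cube F) (integrableOn_cube G)
  | smul c F _ hF =>
    convert! hF.const_smul c using 2 with Y
    · simp only [timeAverage, ContinuousMap.smul_apply]
      rw [intervalIntegral.integral_smul, smul_comm]
    · exact integral_smul c _

/-- **Kronecker–Weyl theorem**: a linear flow on the torus with rationally independent velocities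
is equidistributed. -/
theorem tendsto_timeAverage_linearFlow {s : d → ℝ} (hs : LinearIndependent ℚ s) {y₀ : ℝ}
    (hy₀ : 0 ≤ y₀) (F : C(UnitAddTorus d, ℂ)) :
    Filter.Tendsto (timeAverage (fun y => F (linearFlow s y)) y₀) Filter.atTop
      (nhds (cubeIntegral F)) := by
  rw [Metric.tendsto_nhds]
  intro ε hε
  have hF : F ∈ closure (Submodule.span ℂ (Set.range (mFourier (d := d))) : Set _) := by
    rw [← Submodule.topologicalClosure_coe, span_mFourier_closure_eq_top]
    trivial
  obtain ⟨G, hG, hFG⟩ := Metric.mem_closure_iff.mp hF (ε / 3) (by positivity)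
  rw [dist_eq_norm] at hFG
  filter_upwards [Metric.tendsto_nhds.mp (tendsto_timeAverage_of_mem_span hs y₀ hG) (ε / 3)
    (by positivity), Filter.eventually_gt_atTop y₀] with Y hY hY₀
  have h₁ := norm_timeAverage_linearFlow_le s (F - G) hy₀ hY₀
  have h₂ := norm_cubeIntegral_le (F - G)
  rw [timeAverage_linearFlow_sub, ← dist_eq_norm] at h₁
  rw [cubeIntegral_sub, ← dist_eq_norm, dist_comm] at h₂
  have := dist_triangle4 (timeAverage (fun y => F (linearFlow s y)) y₀ Y)
    (timeAverage (fun y => G (linearFlow s y)) y₀ Y) (cubeIntegral G) (cubeIntegral F)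
  linarith

end UnitAddTorus

/-- If `s₁,…,sₙ` are reals linearly independent over `ℚ`, `a₁,…,aₙ ∈ ℂ`,
`b ∈ ℝ`, `y₀ ≥ 0`, then for every continuous `h : ℝ → ℂ`,
`lim_{Y→∞} (1/Y) ∫_{y₀}^Y h(2 ∑ⱼ Re(aⱼ e^{i sⱼ y}) + b) dy
  = ∫_{[0,1]ⁿ} h(2 ∑ⱼ Re(aⱼ e^{2πi xⱼ}) + b) dx`. -/
theorem stmt_7 (n : ℕ) (hn : 1 ≤ n) (s : Fin n → ℝ)
    (hs : LinearIndependent ℚ s)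
    (a : Fin n → ℂ) (b : ℝ) (y₀ : ℝ) (hy₀ : 0 ≤ y₀)
    (h : ℝ → ℂ) (hh : Continuous h) :
    Filter.Tendsto (fun Y : ℝ => (1 / Y : ℝ) • ∫ y in y₀..Y,
        h (2 * ∑ j, (a j * Complex.exp (Complex.I * (s j : ℂ) * (y : ℂ))).re + b))
      Filter.atTop
      (nhds (∫ x in Set.Icc (0 : Fin n → ℝ) 1,
        h (2 * ∑ j, (a j * Complex.exp (2 * Real.pi * Complex.I * (x j : ℂ))).re + b))) := by
  let F : C(UnitAddTorus (Fin n), ℂ) :=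
    ⟨fun θ => h (2 * ∑ j, (a j * fourier 1 (θ j)).re + b), by fun_prop⟩
  have hflow (y : ℝ) : F (UnitAddTorus.linearFlow s y) =
      h (2 * ∑ j, (a j * Complex.exp (Complex.I * (s j : ℂ) * (y : ℂ))).re + b) := by
    simp only [F, ContinuousMap.coe_mk, UnitAddTorus.linearFlow, fourier_coe_apply]
    congr! 6 with j
    have : (π : ℂ) ≠ 0 := by exact_mod_cast pi_ne_zero
    push_cast
    field_simp
  have hcube (x : Fin n → ℝ) : F (fun j => (x j : UnitAddCircle)) =
      h (2 * ∑ j, (a j * Complex.exp (2 * Real.pi * Complex.I * (x j : ℂ))).re + b) := by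
    simp only [F, ContinuousMap.coe_mk, fourier_coe_apply, Int.cast_one, mul_one,
      Complex.ofReal_one, div_one]
  have key := UnitAddTorus.tendsto_timeAverage_linearFlow hs hy₀ F
  simp only [UnitAddTorus.cubeIntegral, hcube, hflow] at key
  exact key
end

section
/- Let (s_j)_{j∈ℕ} be nonzero real numbers, (a_j)_{j∈ℕ} complex numbers with ∑_j |a_j| < ∞, b ∈ ℝ, y₀ ≥ 0, and C ≥ 0. Let E : [y₀, ∞) → ℝ be a measurable function satisfying |E(y) − (2 ∑_{j} Re(a_j e^{i s_j y}) + b)| ≤ C e^{−y/2} for all y ≥ y₀. Then there exists a Borel probability measure μ on ℝ such that for every Lipschitz function h : ℝ → ℂ, lim_{Y→∞} (1/Y) ∫_{y₀}^Y h(E(y)) dy = ∫_ℝ h dμ. Moreover, for every J ∈ ℕ and every Lipschitz h with Lipschitz constant k_h, |∫_ℝ h dμ − ∫_ℝ h dμ_J| ≤ 2 k_h ∑_{j>J} |a_j|, where μ_J denotes the pushforward, under the map (x₁, …, x_J) ↦ 2 ∑_{j=1}^J Re(a_j e^{2πi x_j}) + b, of the Haar probability measure of the topological closure A_J ⊆ 𝕋^J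 of {(s₁y/(2π), …, s_J y/(2π)) mod ℤ^J : y ∈ ℝ}. -/
open MeasureTheory Real

/-- **Kronecker–Weyl equidistribution**: along a dense one-parameter subgroup of a compact group,
the time averages of a continuous function converge to its integral against any invariant
probability measure. -/
theorem tendsto_average_of_denseRange {G : Type*} [AddCommGroup G] [TopologicalSpace G]
    [IsTopologicalAddGroup G] [CompactSpace G] [SecondCountableTopology G] [MeasurableSpace G]
    [BorelSpace G] (γ : ℝ →+ G) (hγ : Continuous γ) (hd : DenseRange γ) (ν : Measure G)
    [IsProbabilityMeasure ν] (hν : ∀ g : G, ν.map (fun x => g + x) = ν) (f : C(G, ℂ)) :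
    Filter.Tendsto (fun Y : ℝ => (1 / Y : ℝ) • ∫ y in (0 : ℝ)..Y, f (γ y))
      Filter.atTop (nhds (∫ x, f x ∂ν)) := by
  set F : C(G × G, ℂ) := ⟨fun p => f (p.2 + p.1), by fun_prop⟩ with hF
  set φ : C(G, C(G, ℂ)) := F.curry with hφ
  have φ_apply (x z : G) : φ x z = f (z + x) := rfl
  have hint (x : G) (c d : ℝ) : IntervalIntegrable (fun y => f (γ y + x)) volume c d :=
    Continuous.intervalIntegrable (by fun_prop) _ _
  have hint0 (c d : ℝ) : IntervalIntegrable (fun y => f (γ y)) volume c d :=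
    Continuous.intervalIntegrable (by fun_prop) _ _
  rw [Metric.tendsto_atTop]
  intro ε hε
  obtain ⟨t, ht⟩ := isCompact_univ.elim_finite_subcover
    (fun t : ℝ => {x : G | dist (φ x) (φ (γ t)) < ε / 3})
    (fun t => isOpen_lt (by fun_prop) continuous_const) (by
      intro x _
      obtain ⟨t, ht⟩ := hd.exists_mem_open (s := {z : G | dist (φ x) (φ z) < ε / 3})
        (isOpen_lt (by fun_prop) continuous_const) ⟨x, by simpa using by positivity⟩
      exact Set.mem_iUnion.2 ⟨t, ht⟩)
  obtain ⟨T, hT⟩ : ∃ T : ℝ, ∀ r ∈ t, |r| ≤ T := by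
    obtain ⟨T, hT⟩ := (t.image fun r => |r|).bddAbove
    exact ⟨T, fun r hr => hT (by simpa using ⟨r, hr, rfl⟩)⟩
  refine ⟨max 1 (6 * (|T| * ‖f‖) / ε + 1), fun Y hY => ?_⟩
  have hY1 : 1 ≤ Y := (le_max_left _ _).trans hY
  have hY0 : 0 < Y := by linarith
  have hY2 : 6 * (|T| * ‖f‖) / ε < Y := by linarith [(le_max_right 1 _).trans hY]
  have hsmall : 2 * (|T| * ‖f‖) / Y < ε / 3 := by
    rw [div_lt_iff₀ hε] at hY2
    rw [div_lt_iff₀ hY0]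
    linarith
  set M : G → ℂ := fun x => (1 / Y : ℝ) • ∫ y in (0 : ℝ)..Y, f (γ y + x) with hM
  have hM0 : M 0 = (1 / Y : ℝ) • ∫ y in (0 : ℝ)..Y, f (γ y) := by simp [hM]
  have hclose (x : G) : ‖M x - M 0‖ ≤ 2 * ε / 3 := by
    obtain ⟨r, hr, hxr⟩ := Set.mem_iUnion₂.1 (ht (Set.mem_univ x))
    have h1 : ‖M x - M (γ r)‖ ≤ ε / 3 := by
      rw [hM]
      simp only
      rw [← smul_sub, ← intervalIntegral.integral_sub (hint _ _ _) (hint _ _ _), norm_smul]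
      have := intervalIntegral.norm_integral_le_of_norm_le_const (a := 0) (b := Y) (C := ε / 3)
        (f := fun y => f (γ y + x) - f (γ y + γ r)) (fun y _ => by
          rw [← dist_eq_norm]
          exact (ContinuousMap.dist_apply_le_dist (f := φ x) (g := φ (γ r)) (γ y)).trans hxr.le)
      rw [sub_zero, abs_of_pos hY0] at this
      rw [Real.norm_of_nonneg (by positivity), one_div, inv_mul_le_iff₀ hY0]
      linarith
    have h2 : ‖M (γ r) - M 0‖ ≤ 2 * (|T| * ‖f‖) / Y := by
      rw [hM0]
      simp only [hM]
      rw [← smul_sub]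
      have e1 : ∫ y in (0 : ℝ)..Y, f (γ y + γ r) = ∫ y in r..(Y + r), f (γ y) := by
        have := intervalIntegral.integral_comp_add_right (a := 0) (b := Y) (fun y => f (γ y)) r
        simpa [map_add] using this
      have e2 : (∫ y in r..(Y + r), f (γ y)) - ∫ y in (0 : ℝ)..Y, f (γ y)
          = (∫ y in Y..(Y + r), f (γ y)) - ∫ y in (0 : ℝ)..r, f (γ y) := by
        rw [← intervalIntegral.integral_add_adjacent_intervals (hint0 0 r) (hint0 r Y),
          ← intervalIntegral.integral_add_adjacent_intervals (hint0 r Y) (hint0 Y (Y + r))]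
        ring
      have b1 := intervalIntegral.norm_integral_le_of_norm_le_const (a := Y) (b := Y + r)
        (C := ‖f‖) (f := fun y => f (γ y)) (fun y _ => f.norm_coe_le_norm _)
      have b2 := intervalIntegral.norm_integral_le_of_norm_le_const (a := 0) (b := r)
        (C := ‖f‖) (f := fun y => f (γ y)) (fun y _ => f.norm_coe_le_norm _)
      have b3 : ‖f‖ * |r| ≤ |T| * ‖f‖ := by
        rw [mul_comm]
        exact mul_le_mul_of_nonneg_right ((hT r hr).trans (le_abs_self _)) (norm_nonneg _)
      rw [add_sub_cancel_left] at b1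
      rw [sub_zero] at b2
      rw [e1, e2, norm_smul, Real.norm_of_nonneg (by positivity), one_div, inv_mul_eq_div]
      gcongr
      refine (norm_sub_le _ _).trans ?_
      linarith
    calc ‖M x - M 0‖ ≤ ‖M x - M (γ r)‖ + ‖M (γ r) - M 0‖ := norm_sub_le_norm_sub_add_norm_sub ..
      _ ≤ _ := by linarith
  have hswap : ∫ x, M x ∂ν = ∫ x, f x ∂ν := by
    have hinv (y : ℝ) : ∫ x, f (γ y + x) ∂ν = ∫ x, f x ∂ν := by
      conv_rhs => rw [← hν (γ y)]
      rw [integral_map (by fun_prop) (by fun_prop)]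
    have hprod : Integrable (Function.uncurry fun (x : G) (y : ℝ) => f (γ y + x))
        (ν.prod (volume.restrict (Set.Ioc 0 Y))) := by
      refine Integrable.of_bound (Continuous.aestronglyMeasurable ?_) ‖f‖
        (Filter.Eventually.of_forall fun p => f.norm_coe_le_norm _)
      simp only [Function.uncurry_def]
      fun_prop
    simp only [hM, intervalIntegral.integral_of_le hY0.le]
    rw [integral_smul, integral_integral_swap hprod]
    simp only [hinv]
    simp [hY0.le, hY0.ne']
  have hMi : Integrable M ν := by
    have : Continuous M := by
      have h : Continuous fun x : G => ∫ y in (0 : ℝ)..Y, f (γ y + x) :=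
        intervalIntegral.continuous_parametric_intervalIntegral_of_continuous'
          (by simp only [Function.uncurry_def]; fun_prop) _ _
      exact h.const_smul (1 / Y : ℝ)
    exact this.integrable_of_hasCompactSupport (HasCompactSupport.of_compactSpace _)
  rw [← hM0, dist_comm, dist_eq_norm, ← hswap]
  have : (∫ x, M x ∂ν) - M 0 = ∫ x, (M x - M 0) ∂ν := by
    rw [integral_sub hMi (integrable_const _)]
    simp
  rw [this]
  refine (norm_integral_le_of_norm_le_const (Filter.Eventually.of_forall hclose)).trans_lt ?_
  simp
  linarith

/-- The one-parameter subgroup of a torus with direction `c / (2π)`. -/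
noncomputable def linearFlow {ι : Type*} (c : ι → ℝ) : ℝ →+ (ι → AddCircle (1 : ℝ)) where
  toFun y j := ((c j * y / (2 * π) : ℝ) : AddCircle (1 : ℝ))
  map_zero' := by ext j; simp
  map_add' x y := by
    ext j
    rw [Pi.add_apply, ← AddCircle.coe_add]
    congr 1
    ring

theorem continuous_linearFlow {ι : Type*} (c : ι → ℝ) : Continuous (linearFlow c) :=
  continuous_pi fun j => (AddCircle.continuous_mk' 1).comp (by fun_prop)

/-- Equidistribution of a linear flow on a torus of countable dimension in its orbit closure. -/
theorem tendsto_average_linear_flow {ι : Type*} [Countable ι] (c : ι → ℝ)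
    (A : AddSubgroup (ι → AddCircle (1 : ℝ)))
    (hA : (A : Set (ι → AddCircle (1 : ℝ))) = closure (Set.range (linearFlow c)))
    (ν : Measure A) [IsProbabilityMeasure ν] (hν : ∀ g : A, ν.map (fun x => g + x) = ν)
    (f : (ι → AddCircle (1 : ℝ)) → ℂ) (hf : Continuous f) :
    Filter.Tendsto (fun Y : ℝ => (1 / Y : ℝ) • ∫ y in (0 : ℝ)..Y, f (linearFlow c y))
      Filter.atTop (nhds (∫ x : A, f x ∂ν)) := by
  have hclosed : IsClosed (A : Set (ι → AddCircle (1 : ℝ))) := hA ▸ isClosed_closure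
  have : CompactSpace A := isCompact_iff_compactSpace.1 hclosed.isCompact
  have hδ : Continuous (linearFlow c) := continuous_linearFlow c
  have hmem (y : ℝ) : linearFlow c y ∈ A := by
    rw [← SetLike.mem_coe, hA]
    exact subset_closure ⟨y, rfl⟩
  let γ : ℝ →+ A := (linearFlow c).codRestrict A hmem
  have hγ : Continuous γ := hδ.subtype_mk hmem
  have hdense : DenseRange γ := by
    intro x
    rw [closure_subtype]
    have : ((↑) '' Set.range γ : Set (ι → AddCircle (1 : ℝ))) = Set.range (linearFlow c) := by
      rw [← Set.range_comp]
      rfl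
    rw [this]
    exact hA ▸ x.2
  have : SecondCountableTopology A :=
    TopologicalSpace.Subtype.secondCountableTopology (A : Set (ι → AddCircle (1 : ℝ)))
  exact tendsto_average_of_denseRange γ hγ hdense ν hν ⟨fun x : A => f x, by fun_prop⟩

/-- A compact group carries an invariant probability measure. -/
theorem exists_isProbabilityMeasure_map_add_left_eq {G : Type*} [AddCommGroup G]
    [TopologicalSpace G] [IsTopologicalAddGroup G] [CompactSpace G] [MeasurableSpace G]
    [BorelSpace G] :
    ∃ ν : Measure G, IsProbabilityMeasure ν ∧ ∀ g : G, ν.map (fun x => g + x) = ν :=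
  ⟨Measure.addHaarMeasure ⊤, ⟨Measure.addHaarMeasure_self⟩, fun g => map_add_left_eq_self _ g⟩

theorem toCircle_linearFlow {ι : Type*} (c : ι → ℝ) (y : ℝ) (j : ι) :
    ((AddCircle.toCircle (linearFlow c y j) : Circle) : ℂ)
      = Complex.exp (Complex.I * (c j : ℂ) * (y : ℂ)) := by
  change ((AddCircle.toCircle ((c j * y / (2 * π) : ℝ) : AddCircle (1 : ℝ)) : Circle) : ℂ) = _
  rw [AddCircle.toCircle_apply_mk, Circle.coe_exp]
  congr 1
  push_cast
  have : (π : ℂ) ≠ 0 := by exact_mod_cast Real.pi_ne_zero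
  field_simp

theorem norm_re_mul_circle_le (z : ℂ) (w : Circle) : ‖(z * (w : ℂ)).re‖ ≤ ‖z‖ := by
  simpa only [Real.norm_eq_abs, norm_mul, Circle.norm_coe, mul_one] using
    Complex.abs_re_le_norm (z * (w : ℂ))

/-- Time averages of exponentially close functions have the same limits. -/
theorem tendsto_average_of_norm_sub_le_exp {f g : ℝ → ℂ} {y₀ D : ℝ} {l : ℂ} (hD : 0 ≤ D)
    (hf : Continuous f) (hg : Measurable g)
    (hfg : ∀ y, y₀ ≤ y → ‖g y - f y‖ ≤ D * Real.exp (-(y / 2)))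
    (hl : Filter.Tendsto (fun Y : ℝ => (1 / Y : ℝ) • ∫ y in (0 : ℝ)..Y, f y)
      Filter.atTop (nhds l)) :
    Filter.Tendsto (fun Y : ℝ => (1 / Y : ℝ) • ∫ y in y₀..Y, g y) Filter.atTop (nhds l) := by
  set B : ℝ := D * (2 * Real.exp (-(y₀ / 2))) + ‖∫ y in (0 : ℝ)..y₀, f y‖ with hB
  have hzero : Filter.Tendsto (fun Y : ℝ => (1 / Y : ℝ) •
      ((∫ y in y₀..Y, g y) - ∫ y in (0 : ℝ)..Y, f y)) Filter.atTop (nhds 0) := by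
    refine squeeze_zero_norm' (a := fun Y : ℝ => B / Y) ?_
      (tendsto_const_nhds.div_atTop Filter.tendsto_id)
    filter_upwards [Filter.eventually_ge_atTop y₀, Filter.eventually_gt_atTop 0] with Y hY hY0
    have hmaj : IntervalIntegrable (fun y => D * Real.exp (-(y / 2))) volume y₀ Y :=
      Continuous.intervalIntegrable (by fun_prop) _ _
    have hdiff : IntervalIntegrable (fun y => g y - f y) volume y₀ Y := by
      refine hmaj.mono_fun (hg.sub hf.measurable).aestronglyMeasurable ?_
      filter_upwards [ae_restrict_mem measurableSet_uIoc] with y hy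
      rw [Set.uIoc_of_le hY] at hy
      exact (hfg y hy.1.le).trans (le_abs_self _)
    have hfi (c d : ℝ) : IntervalIntegrable f volume c d := hf.intervalIntegrable _ _
    have hsplit : (∫ y in y₀..Y, g y) - ∫ y in (0 : ℝ)..Y, f y
        = (∫ y in y₀..Y, (g y - f y)) - ∫ y in (0 : ℝ)..y₀, f y := by
      have : ∫ y in y₀..Y, g y = ∫ y in y₀..Y, ((g y - f y) + f y) := by simp
      rw [this, intervalIntegral.integral_add hdiff (hfi _ _),
        ← intervalIntegral.integral_add_adjacent_intervals (hfi 0 y₀) (hfi y₀ Y)]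
      ring
    have hexp : ∫ y in y₀..Y, D * Real.exp (-(y / 2))
        = D * (-2 * Real.exp (-(Y / 2))) - D * (-2 * Real.exp (-(y₀ / 2))) := by
      refine intervalIntegral.integral_eq_sub_of_hasDerivAt
        (f := fun y => D * (-2 * Real.exp (-(y / 2)))) (fun y _ => ?_) hmaj
      have h := (((((hasDerivAt_id y).div_const 2).neg).exp).const_mul (-2)).const_mul D
      exact h.congr_deriv (by simp only [Pi.neg_apply, id]; ring)
    have hmain : ‖∫ y in y₀..Y, (g y - f y)‖ ≤ D * (2 * Real.exp (-(y₀ / 2))) := by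
      refine (intervalIntegral.norm_integral_le_of_norm_le hY
        (Filter.Eventually.of_forall fun y hy => hfg y hy.1.le) hmaj).trans ?_
      rw [hexp]
      have : 0 ≤ D * (2 * Real.exp (-(Y / 2))) := by positivity
      linarith
    rw [hsplit, norm_smul, Real.norm_of_nonneg (by positivity), one_div, inv_mul_eq_div]
    gcongr
    exact (norm_sub_le _ _).trans (by linarith)
  have := hzero.add hl
  rw [zero_add] at this
  refine this.congr fun Y => ?_
  rw [← smul_add, sub_add_cancel]

/-- Let `(s_j)` be nonzero reals, `(a_j) ∈ ℂ` with `∑ |a_j| < ∞`, `b ∈ ℝ`,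
`y₀ ≥ 0`, `C ≥ 0`, and let `E` be measurable with
`|E(y) - (2 ∑_j Re(a_j e^{i s_j y}) + b)| ≤ C e^{-y/2}` for `y ≥ y₀`. Then there is a Borel
probability measure `μ` on `ℝ` such that for every Lipschitz `h : ℝ → ℂ`,
`(1/Y)∫_{y₀}^Y h(E(y)) dy → ∫ h dμ`; moreover for every `J` and every Lipschitz `h` with
constant `k`, `|∫ h dμ - ∫ h dμ_J| ≤ 2 k ∑_{j ≥ J} |a_j|`, where `μ_J` is the pushforward,
under `(x_0,…,x_{J-1}) ↦ 2 ∑_{j<J} Re(a_j e^{2πi x_j}) + b`, of the Haar probability measure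
of the closure `A_J ⊆ 𝕋^J` of `{(s_0 y/2π, …, s_{J-1} y/2π) : y ∈ ℝ}`. -/
theorem stmt_8 (s : ℕ → ℝ) (hs : ∀ j, s j ≠ 0) (a : ℕ → ℂ)
    (ha : Summable fun j => ‖a j‖) (b y₀ C : ℝ) (hy₀ : 0 ≤ y₀) (hC : 0 ≤ C)
    (E : ℝ → ℝ) (hE : Measurable E)
    (hEapprox : ∀ y : ℝ, y₀ ≤ y →
      |E y - (2 * ∑' j : ℕ, (a j * Complex.exp (Complex.I * (s j : ℂ) * (y : ℂ))).re + b)|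
        ≤ C * Real.exp (-(y / 2))) :
    ∃ μ : Measure ℝ, IsProbabilityMeasure μ ∧
      (∀ (h : ℝ → ℂ) (k : NNReal), LipschitzWith k h →
        Filter.Tendsto (fun Y : ℝ => (1 / Y : ℝ) • ∫ y in y₀..Y, h (E y))
          Filter.atTop (nhds (∫ x : ℝ, h x ∂μ))) ∧
      (∀ (J : ℕ) (h : ℝ → ℂ) (k : NNReal), LipschitzWith k h →
        ∀ (A : AddSubgroup (Fin J → AddCircle (1 : ℝ))),
          (A : Set (Fin J → AddCircle (1 : ℝ))) =
            closure (Set.range fun y : ℝ => fun j : Fin J =>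
              ((s j * y / (2 * Real.pi) : ℝ) : AddCircle (1 : ℝ))) →
        ∀ (μA : Measure A), IsProbabilityMeasure μA →
          (∀ g : A, μA.map (fun x => g + x) = μA) →
          ‖(∫ x : ℝ, h x ∂μ) -
              ∫ x : ℝ, h x ∂(μA.map (fun x : A =>
                2 * ∑ j : Fin J,
                  (a j * ((AddCircle.toCircle ((x : Fin J → AddCircle (1 : ℝ)) j) : Circle) : ℂ)).re
                  + b))‖
            ≤ 2 * (k : ℝ) * ∑' m : ℕ, ‖a (J + m)‖) := by
  set F : (ℕ → AddCircle (1 : ℝ)) → ℝ := fun x => 2 * ∑' j, (a j * ((AddCircle.toCircle (x j) : Circle) : ℂ)).re + b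
    with hFdef
  have hF : Continuous F := by
    refine (Continuous.const_mul ?_ _).add continuous_const
    refine continuous_tsum (fun j => ?_) ha fun j x => norm_re_mul_circle_le _ _
    have := AddCircle.continuous_toCircle (T := (1 : ℝ))
    fun_prop
  set δ : ℝ →+ (ℕ → AddCircle (1 : ℝ)) := linearFlow s
  have hδ : Continuous δ := continuous_linearFlow s
  set K : AddSubgroup (ℕ → AddCircle (1 : ℝ)) := δ.range.topologicalClosure
  have hA : (K : Set (ℕ → AddCircle (1 : ℝ))) = closure (Set.range δ) := rfl
  have : CompactSpace K :=
    isCompact_iff_compactSpace.1 (AddSubgroup.isClosed_topologicalClosure _).isCompact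
  obtain ⟨ν, hν, hνinv⟩ := exists_isProbabilityMeasure_map_add_left_eq (G := K)
  have hFA : Continuous fun x : K => F x := by fun_prop
  have hlim (h : ℝ → ℂ) (hh : Continuous h) :
      Filter.Tendsto (fun Y : ℝ => (1 / Y : ℝ) • ∫ y in (0 : ℝ)..Y, h (F (δ y)))
        Filter.atTop (nhds (∫ x, h x ∂(ν.map fun x : K => F x))) := by
    rw [integral_map hFA.aemeasurable hh.aestronglyMeasurable]
    exact tendsto_average_linear_flow s K hA ν hνinv (fun x => h (F x)) (hh.comp hF)
  refine ⟨ν.map fun x : K => F x, Measure.isProbabilityMeasure_map hFA.aemeasurable, ?_, ?_⟩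
  · intro h k hk
    refine tendsto_average_of_norm_sub_le_exp (D := k * C) (by positivity)
      (hk.continuous.comp (hF.comp hδ)) (hk.continuous.measurable.comp hE) (fun y hy => ?_)
      (hlim h hk.continuous)
    have h1 := hEapprox y hy
    have h2 := hk.dist_le_mul (E y) (F (δ y))
    rw [dist_eq_norm, Real.dist_eq] at h2
    have h3 : F (δ y)
        = 2 * ∑' j : ℕ, (a j * Complex.exp (Complex.I * (s j : ℂ) * (y : ℂ))).re + b := by
      simp only [hFdef, δ, toCircle_linearFlow]
    rw [← h3] at h1
    calc _ ≤ _ := h2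
      _ ≤ k * (C * Real.exp (-(y / 2))) := by gcongr
      _ = _ := by ring
  · intro J h k hk A hAJ μA hμA hinv
    set FJ : (Fin J → AddCircle (1 : ℝ)) → ℝ := fun x =>
      2 * ∑ j : Fin J, (a j * ((AddCircle.toCircle (x j) : Circle) : ℂ)).re + b with hFJdef
    have hFJ : Continuous FJ := by
      have := AddCircle.continuous_toCircle (T := (1 : ℝ))
      fun_prop
    have hFJA : Continuous fun x : A => FJ x := by fun_prop
    have hmap := integral_map (μ := μA) hFJA.aemeasurable
      (hk.continuous.aestronglyMeasurable (μ := μA.map fun x : A => FJ x))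
    simp only [hFJdef] at hmap
    rw [hmap]
    set δJ : ℝ →+ (Fin J → AddCircle (1 : ℝ)) := linearFlow fun j : Fin J => s j
    have hδJ : Continuous δJ := continuous_linearFlow _
    have hlimJ := tendsto_average_linear_flow (fun j : Fin J => s j) A hAJ μA hinv
      (fun x => h (FJ x)) (hk.continuous.comp hFJ)
    refine le_of_tendsto ((hlim h hk.continuous).sub hlimJ).norm ?_
    filter_upwards [Filter.eventually_gt_atTop 0] with Y hY
    have htail (y : ℝ) : |F (δ y) - FJ (δJ y)| ≤ 2 * ∑' m : ℕ, ‖a (J + m)‖ := by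
      set u : ℕ → ℝ := fun j => (a j * ((AddCircle.toCircle (δ y j) : Circle) : ℂ)).re with hu
      have hus : Summable u := ha.of_norm_bounded fun j => norm_re_mul_circle_le _ _
      have hF' : F (δ y) = 2 * (∑ j ∈ Finset.range J, u j + ∑' m, u (J + m)) + b := by
        have := hus.sum_add_tsum_nat_add J
        simp only [add_comm _ J] at this
        rw [this]
      have hFJ' : FJ (δJ y) = 2 * ∑ j ∈ Finset.range J, u j + b := by
        rw [← Fin.sum_univ_eq_sum_range]
        rfl
      have haJ : Summable fun m => ‖a (J + m)‖ := by
        simpa only [add_comm] using (summable_nat_add_iff J).2 ha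
      have hb : ‖∑' m, u (J + m)‖ ≤ ∑' m : ℕ, ‖a (J + m)‖ :=
        tsum_of_norm_bounded haJ.hasSum fun m => norm_re_mul_circle_le _ _
      have : F (δ y) - FJ (δJ y) = 2 * ∑' m, u (J + m) := by rw [hF', hFJ']; ring
      rw [this, abs_mul, abs_two]
      exact mul_le_mul_of_nonneg_left hb zero_le_two
    have hi : IntervalIntegrable (fun y => h (F (δ y))) volume 0 Y :=
      (hk.continuous.comp (hF.comp hδ)).intervalIntegrable _ _
    have hiJ : IntervalIntegrable (fun y => h (FJ (δJ y))) volume 0 Y :=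
      (hk.continuous.comp (hFJ.comp hδJ)).intervalIntegrable _ _
    rw [← smul_sub, ← intervalIntegral.integral_sub hi hiJ, norm_smul]
    have hbd := intervalIntegral.norm_integral_le_of_norm_le_const (a := 0) (b := Y)
      (C := 2 * (k : ℝ) * ∑' m : ℕ, ‖a (J + m)‖)
      (f := fun y => h (F (δ y)) - h (FJ (δJ y))) (fun y _ => by
        have h2 := hk.dist_le_mul (F (δ y)) (FJ (δJ y))
        rw [dist_eq_norm, Real.dist_eq] at h2
        calc _ ≤ _ := h2
          _ ≤ k * (2 * ∑' m : ℕ, ‖a (J + m)‖) := by gcongr; exact htail y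
          _ = _ := by ring)
    rw [sub_zero, abs_of_pos hY] at hbd
    rw [Real.norm_of_nonneg (by positivity), one_div, inv_mul_le_iff₀ hY, mul_comm Y]
    exact hbd
end

section
/- Let (s_j)_{j∈ℕ} be nonzero real numbers, (a_j)_{j∈ℕ} complex numbers with ∑_j |a_j| < ∞, b ∈ ℝ, y₀ ≥ 0, and C ≥ 0, and let E : [y₀, ∞) → ℝ be measurable with |E(y) − (2 ∑_{j} Re(a_j e^{i s_j y}) + b)| ≤ C e^{−y/2} for all y ≥ y₀. Then every Borel probability measure μ on ℝ satisfying lim_{Y→∞} (1/Y) ∫_{y₀}^Y h(E(y)) dy = ∫_ℝ h dμ for all Lipschitz h : ℝ → ℂ has mean b (that is, ∫_ℝ x dμ(x) = b) and is supported in the compact interval [b − 2 ∑_j |a_j| − C e^{−y₀/2}, b + 2 ∑_j |a_j| + C e^{−y₀/2}]. -/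
open MeasureTheory Real

open Filter Topology in
/-- The mean value of an absolutely convergent trigonometric series without constant term is zero. -/
theorem tendsto_average_tsum_exp (s : ℕ → ℝ) (hs : ∀ j, s j ≠ 0) (a : ℕ → ℂ)
    (ha : Summable fun j => ‖a j‖) (y₀ : ℝ) (hy₀ : 0 ≤ y₀) :
    Tendsto (fun Y : ℝ => ((1 / Y : ℝ) : ℂ) *
      ∫ y in y₀..Y, ∑' j, a j * Complex.exp (Complex.I * (s j : ℂ) * (y : ℂ)))
      atTop (𝓝 0) := by
  have hnorm : ∀ (j : ℕ) (y : ℝ), ‖Complex.exp (Complex.I * (s j : ℂ) * (y : ℂ))‖ = 1 := by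
    intro j y
    rw [show Complex.I * (s j : ℂ) * (y : ℂ) = ((s j * y : ℝ) : ℂ) * Complex.I by push_cast; ring]
    exact Complex.norm_exp_ofReal_mul_I _
  have hswap : ∀ Y : ℝ,
      ((1 / Y : ℝ) : ℂ) * ∫ y in y₀..Y, ∑' j, a j * Complex.exp (Complex.I * (s j : ℂ) * (y : ℂ))
        = ∑' j, ((1 / Y : ℝ) : ℂ) *
          ∫ y in y₀..Y, a j * Complex.exp (Complex.I * (s j : ℂ) * (y : ℂ)) := by
    intro Y
    rw [tsum_mul_left]
    congr 1
    refine (intervalIntegral.hasSum_integral_of_dominated_convergence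
      (fun j _ => ‖a j‖) ?_ ?_ ?_ ?_ ?_).tsum_eq.symm
    · intro j
      exact Continuous.aestronglyMeasurable (by fun_prop)
    · intro j
      refine ae_of_all _ fun y _ => ?_
      rw [norm_mul, hnorm, mul_one]
    · exact ae_of_all _ fun _ _ => ha
    · exact intervalIntegrable_const
    · refine ae_of_all _ fun y _ => Summable.hasSum ?_
      refine Summable.of_norm_bounded ha fun j => ?_
      rw [norm_mul, hnorm, mul_one]
  simp_rw [hswap]
  rw [show (0 : ℂ) = ∑' _ : ℕ, (0 : ℂ) by simp]
  refine tendsto_tsum_of_dominated_convergence ha ?_ ?_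
  · intro j
    have hne : Complex.I * (s j : ℂ) ≠ 0 := by
      simpa using hs j
    have hlim : Tendsto (fun Y : ℝ => 1 / Y * (‖a j‖ * (2 / ‖Complex.I * (s j : ℂ)‖)))
        atTop (𝓝 0) := by
      simpa using (tendsto_inv_atTop_zero (𝕜 := ℝ)).mul_const
        (‖a j‖ * (2 / ‖Complex.I * (s j : ℂ)‖))
    refine squeeze_zero_norm' ?_ hlim
    filter_upwards [eventually_gt_atTop 0] with Y hY
    rw [intervalIntegral.integral_const_mul, integral_exp_mul_complex hne, norm_mul, norm_mul,
      norm_div, Complex.norm_real, Real.norm_of_nonneg (by positivity)]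
    gcongr
    refine (norm_sub_le _ _).trans ?_
    rw [hnorm, hnorm]
    norm_num
  · filter_upwards [eventually_gt_atTop 0, eventually_ge_atTop y₀] with Y hY hyY j
    have hbound : ‖∫ y in y₀..Y, a j * Complex.exp (Complex.I * (s j : ℂ) * (y : ℂ))‖
        ≤ ‖a j‖ * |Y - y₀| := by
      refine intervalIntegral.norm_integral_le_of_norm_le_const fun y _ => ?_
      rw [norm_mul, hnorm, mul_one]
    rw [norm_mul, Complex.norm_real, Real.norm_of_nonneg (by positivity), one_div,
      inv_mul_le_iff₀ hY]
    refine hbound.trans ?_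
    rw [abs_of_nonneg (by linarith), mul_comm]
    gcongr
    linarith

/-- With `(s_j)` nonzero, `∑|a_j| < ∞`, `b ∈ ℝ`, `y₀ ≥ 0`, `C ≥ 0`, and `E`
measurable with `|E(y) - (2 ∑_j Re(a_j e^{i s_j y}) + b)| ≤ C e^{-y/2}` for `y ≥ y₀`:
every Borel probability measure `μ` on `ℝ` with
`(1/Y)∫_{y₀}^Y h(E(y)) dy → ∫ h dμ` for all Lipschitz `h` has mean `b` and is supported in
`[b - 2∑|a_j| - C e^{-y₀/2}, b + 2∑|a_j| + C e^{-y₀/2}]`. -/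
theorem stmt_9 (s : ℕ → ℝ) (hs : ∀ j, s j ≠ 0) (a : ℕ → ℂ)
    (ha : Summable fun j => ‖a j‖) (b y₀ C : ℝ) (hy₀ : 0 ≤ y₀) (hC : 0 ≤ C)
    (E : ℝ → ℝ) (hE : Measurable E)
    (hEapprox : ∀ y : ℝ, y₀ ≤ y →
      |E y - (2 * ∑' j : ℕ, (a j * Complex.exp (Complex.I * (s j : ℂ) * (y : ℂ))).re + b)|
        ≤ C * Real.exp (-(y / 2)))
    (μ : Measure ℝ) (hμ : IsProbabilityMeasure μ)
    (hlim : ∀ (h : ℝ → ℂ), (∃ k : NNReal, LipschitzWith k h) →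
      Filter.Tendsto (fun Y : ℝ => (1 / Y : ℝ) • ∫ y in y₀..Y, h (E y))
        Filter.atTop (nhds (∫ x : ℝ, h x ∂μ))) :
    (∫ x : ℝ, x ∂μ) = b ∧
    μ ((Set.Icc (b - 2 * (∑' j : ℕ, ‖a j‖) - C * Real.exp (-(y₀ / 2)))
        (b + 2 * (∑' j : ℕ, ‖a j‖) + C * Real.exp (-(y₀ / 2))))ᶜ) = 0 := by
  have hterm : ∀ (j : ℕ) (y : ℝ),
      ‖a j * Complex.exp (Complex.I * (s j : ℂ) * (y : ℂ))‖ ≤ ‖a j‖ := by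
    intro j y
    rw [show Complex.I * (s j : ℂ) * (y : ℂ) = ((s j * y : ℝ) : ℂ) * Complex.I by push_cast; ring,
      norm_mul, Complex.norm_exp_ofReal_mul_I, mul_one]
  set g : ℝ → ℂ := fun y => ∑' j, a j * Complex.exp (Complex.I * (s j : ℂ) * (y : ℂ)) with hg
  have hsum : ∀ y : ℝ, Summable fun j => a j * Complex.exp (Complex.I * (s j : ℂ) * (y : ℂ)) :=
    fun y => Summable.of_norm_bounded ha fun j => hterm j y
  have hre : ∀ y : ℝ,
      ∑' j : ℕ, (a j * Complex.exp (Complex.I * (s j : ℂ) * (y : ℂ))).re = (g y).re :=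
    fun y => (Complex.re_tsum (hsum y)).symm
  simp_rw [hre] at hEapprox
  have hgc : Continuous g := continuous_tsum (fun j => by fun_prop) ha hterm
  have hgre : Continuous fun y => (g y).re := Complex.continuous_re.comp hgc
  have hgnorm : ∀ y, |(g y).re| ≤ ∑' j, ‖a j‖ := fun y =>
    (Complex.abs_re_le_norm _).trans (tsum_of_norm_bounded ha.hasSum fun j => hterm j y)
  have hdecay : ∀ y, y₀ ≤ y → C * Real.exp (-(y / 2)) ≤ C * Real.exp (-(y₀ / 2)) := by
    intro y hy
    gcongr
  constructor
  · have hid : Filter.Tendsto (fun Y : ℝ => 1 / Y * ∫ y in y₀..Y, E y) Filter.atTop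
        (nhds (∫ x : ℝ, x ∂μ)) := by
      have h := hlim (fun x => (x : ℂ)) ⟨1, Complex.isometry_ofReal.lipschitz⟩
      have h' := (Complex.continuous_re.tendsto _).comp h
      rw [integral_complex_ofReal, Complex.ofReal_re] at h'
      refine h'.congr fun Y => ?_
      simp [intervalIntegral.integral_ofReal]
    refine tendsto_nhds_unique hid ?_
    set R : ℝ → ℝ := fun y => E y - (2 * (g y).re + b) with hR
    have hRm : Measurable R := hE.sub ((hgre.measurable.const_mul 2).add_const b)
    have hexp : ∀ u v : ℝ, IntervalIntegrable (fun y => C * Real.exp (-(y / 2))) volume u v :=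
      fun u v => Continuous.intervalIntegrable (by fun_prop) u v
    have hRint : ∀ Y, y₀ ≤ Y → IntervalIntegrable R volume y₀ Y := by
      intro Y hY
      refine (hexp y₀ Y).mono_fun' hRm.aestronglyMeasurable ?_
      rw [Set.uIoc_of_le hY]
      exact (ae_restrict_mem measurableSet_Ioc).mono fun y hy => hEapprox y hy.1.le
    have hRbound : ∀ Y, y₀ ≤ Y → |∫ y in y₀..Y, R y| ≤ 2 * C := by
      intro Y hY
      have h1 : ‖∫ y in y₀..Y, R y‖ ≤ ∫ y in y₀..Y, C * Real.exp (-(y / 2)) :=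
        intervalIntegral.norm_integral_le_of_norm_le hY
          (ae_of_all _ fun y hy => hEapprox y hy.1.le) (hexp y₀ Y)
      have h2 : ∫ y in y₀..Y, C * Real.exp (-(y / 2))
          = -2 * C * Real.exp (-(Y / 2)) - -2 * C * Real.exp (-(y₀ / 2)) := by
        refine intervalIntegral.integral_eq_sub_of_hasDerivAt
          (f := fun y => -2 * C * Real.exp (-(y / 2))) (fun y _ => ?_) (hexp y₀ Y)
        have h := ((((hasDerivAt_id y).div_const 2).neg).exp).const_mul (-2 * C)
        refine h.congr_deriv ?_
        simp only [Pi.neg_apply, id]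
        ring
      have h3 : C * Real.exp (-(y₀ / 2)) ≤ C * 1 := by
        gcongr
        exact Real.exp_le_one_iff.2 (by linarith)
      have h4 : 0 ≤ C * Real.exp (-(Y / 2)) := by positivity
      rw [Real.norm_eq_abs] at h1
      linarith
    have hRlim : Filter.Tendsto (fun Y : ℝ => 1 / Y * ∫ y in y₀..Y, R y) Filter.atTop
        (nhds 0) := by
      have h0 : Filter.Tendsto (fun Y : ℝ => 1 / Y * (2 * C)) Filter.atTop (nhds 0) := by
        simpa using (tendsto_inv_atTop_zero (𝕜 := ℝ)).mul_const (2 * C)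
      refine squeeze_zero_norm' ?_ h0
      filter_upwards [Filter.eventually_gt_atTop 0, Filter.eventually_ge_atTop y₀] with Y hY hyY
      rw [norm_mul, Real.norm_of_nonneg (by positivity)]
      gcongr
      exact hRbound Y hyY
    have hglim : Filter.Tendsto (fun Y : ℝ => 1 / Y * ∫ y in y₀..Y, (g y).re) Filter.atTop
        (nhds 0) := by
      have h := (Complex.continuous_re.tendsto _).comp (tendsto_average_tsum_exp s hs a ha y₀ hy₀)
      rw [Complex.zero_re] at h
      refine h.congr fun Y => ?_
      rw [Function.comp_apply, Complex.re_ofReal_mul]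
      congr 1
      exact (Complex.reCLM.intervalIntegral_comp_comm (hgc.intervalIntegrable y₀ Y)).symm
    have hblim : Filter.Tendsto (fun Y : ℝ => b - 1 / Y * (y₀ * b)) Filter.atTop (nhds b) := by
      simpa using ((tendsto_inv_atTop_zero (𝕜 := ℝ)).mul_const (y₀ * b)).const_sub b
    have htot := (hRlim.add (hglim.const_mul 2)).add hblim
    simp only [mul_zero, zero_add] at htot
    refine htot.congr' ?_
    filter_upwards [Filter.eventually_gt_atTop 0, Filter.eventually_ge_atTop y₀] with Y hY hyY
    have hsplit : ∫ y in y₀..Y, E y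
        = (∫ y in y₀..Y, R y) + (2 * (∫ y in y₀..Y, (g y).re) + (Y - y₀) * b) := by
      have hg2 : IntervalIntegrable (fun y => 2 * (g y).re) volume y₀ Y :=
        (hgre.const_mul 2).intervalIntegrable _ _
      rw [← intervalIntegral.integral_const_mul, ← smul_eq_mul (Y - y₀) b,
        ← intervalIntegral.integral_const,
        ← intervalIntegral.integral_add hg2 intervalIntegrable_const,
        ← intervalIntegral.integral_add (hRint Y hyY) (hg2.add intervalIntegrable_const)]
      refine intervalIntegral.integral_congr fun y _ => ?_
      simp [hR]
    rw [hsplit]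
    field_simp
    ring
  · set I : Set ℝ := Set.Icc (b - 2 * (∑' j : ℕ, ‖a j‖) - C * Real.exp (-(y₀ / 2)))
        (b + 2 * (∑' j : ℕ, ‖a j‖) + C * Real.exp (-(y₀ / 2))) with hI
    have hmem : ∀ y, y₀ ≤ y → E y ∈ I := by
      intro y hy
      have h1 := abs_le.1 ((hEapprox y hy).trans (hdecay y hy))
      have h2 := abs_le.1 (hgnorm y)
      constructor <;> linarith
    set d : ℝ → ℝ := fun x => min (Metric.infDist x I) 1 with hd
    have hdlip : LipschitzWith 1 d := (Metric.lipschitz_infDist_pt I).min_const 1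
    have hd0 : ∀ x, 0 ≤ d x := fun x => le_min Metric.infDist_nonneg zero_le_one
    have hdint : Integrable d μ :=
      Integrable.of_bound hdlip.continuous.aestronglyMeasurable 1
        (ae_of_all _ fun x => by
          rw [Real.norm_of_nonneg (hd0 x)]
          exact min_le_right _ _)
    have hzero : ∫ x, d x ∂μ = 0 := by
      have h := hlim (fun x => (d x : ℂ))
        ⟨1 * 1, Complex.isometry_ofReal.lipschitz.comp hdlip⟩
      rw [integral_complex_ofReal] at h
      have h0 : (fun Y : ℝ => (1 / Y : ℝ) • ∫ y in y₀..Y, ((d (E y) : ℝ) : ℂ))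
          =ᶠ[Filter.atTop] fun _ => 0 := by
        filter_upwards [Filter.eventually_ge_atTop y₀] with Y hY
        rw [intervalIntegral.integral_congr (g := fun _ => (0 : ℂ)) fun y hy => ?_]
        · simp
        · rw [Set.uIcc_of_le hY] at hy
          simp [hd, Metric.infDist_zero_of_mem (hmem y hy.1)]
      exact Complex.ofReal_eq_zero.1 (tendsto_nhds_unique h (tendsto_const_nhds.congr' h0.symm))
    have hae := (integral_eq_zero_iff_of_nonneg hd0 hdint).1 hzero
    refine measure_mono_null (fun x hx => ?_) (ae_iff.1 hae)
    have hpos : 0 < Metric.infDist x I :=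
      (isClosed_Icc.notMem_iff_infDist_pos ⟨E y₀, hmem y₀ le_rfl⟩).1 hx
    exact (lt_min hpos one_pos).ne'
end

section
/- Let (s_j)_{j∈ℕ} be nonzero real numbers that are linearly independent over ℚ (every finite subfamily is ℚ-linearly independent), let (a_j)_{j∈ℕ} be complex numbers with ∑_j |a_j| < ∞, b ∈ ℝ, y₀ ≥ 0, C ≥ 0, and let E : [y₀, ∞) → ℝ be measurable with |E(y) − (2 ∑_{j} Re(a_j e^{i s_j y}) + b)| ≤ C e^{−y/2} for all y ≥ y₀. Then every Borel probability measure μ on ℝ satisfying lim_{Y→∞} (1/Y) ∫_{y₀}^Y h(E(y)) dy = ∫_ℝ h dμ for all Lipschitz h : ℝ → ℂ has Fourier transform ∫_ℝ e^{−iξx} dμ(x) = e^{−iξb} · lim_{n→∞} ∏_{j=1}^n (1/π) ∫_0^π cos(2ξ|a_j| cos t) dt for every ξ ∈ ℝ; in particular, the limit of partial products on the right exists. (Each factor (1/π) ∫_0^π cos(2ξ|a_j| cos t) dt equals the Bessel function J₀(2ξ|a_j|).) -/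
open MeasureTheory Real

open Filter Topology

theorem norm_exp_neg_I_mul_sub_le (ξ x y : ℝ) :
    ‖Complex.exp (-(Complex.I * ξ * x)) - Complex.exp (-(Complex.I * ξ * y))‖
      ≤ |ξ| * |x - y| := by
  have h : Complex.exp (-(Complex.I * ξ * x)) - Complex.exp (-(Complex.I * ξ * y))
      = Complex.exp ((-(ξ * y) : ℝ) * Complex.I)
        * (Complex.exp (Complex.I * (-(ξ * (x - y)) : ℝ)) - 1) := by
    rw [mul_sub, ← Complex.exp_add, mul_one]
    congr 2 <;> · push_cast; ring
  rw [h, norm_mul, Complex.norm_exp_ofReal_mul_I, one_mul]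
  refine Real.norm_exp_I_mul_ofReal_sub_one_le.trans ?_
  rw [norm_neg, norm_mul, Real.norm_eq_abs, Real.norm_eq_abs]

/-- A nonconstant complex exponential has vanishing mean along the half-line. -/
theorem tendsto_mean_exp_mul_I_zero {ω : ℝ} (hω : ω ≠ 0) (y₀ : ℝ) :
    Tendsto (fun Y : ℝ => (1 / Y : ℝ) • ∫ y in y₀..Y, Complex.exp (Complex.I * ω * y))
      atTop (𝓝 0) := by
  have hc : Complex.I * ω ≠ 0 := mul_ne_zero Complex.I_ne_zero (by exact_mod_cast hω)
  have hn (y : ℝ) : ‖Complex.exp (Complex.I * ω * y)‖ = 1 := by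
    rw [show Complex.I * ω * y = ((ω * y : ℝ) : ℂ) * Complex.I by push_cast; ring,
      Complex.norm_exp_ofReal_mul_I]
  refine (Tendsto.zero_smul_isBoundedUnder_le (f := fun Y : ℝ => 1 / Y) ?_ ?_)
  · simpa using tendsto_inv_atTop_zero (𝕜 := ℝ)
  · refine isBoundedUnder_of ⟨2 / ‖Complex.I * ω‖, fun Y => ?_⟩
    simp only [Function.comp_apply, integral_exp_mul_complex hc, norm_div]
    gcongr
    refine (norm_sub_le _ _).trans ?_
    rw [hn, hn]; norm_num

theorem tendsto_mean_const (y₀ : ℝ) (c : ℂ) :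
    Tendsto (fun Y : ℝ => (1 / Y : ℝ) • ∫ _y in y₀..Y, c) atTop (𝓝 c) := by
  have h : Tendsto (fun Y : ℝ => (1 - y₀ * Y⁻¹) • c) atTop (𝓝 ((1 - y₀ * 0) • c)) :=
    ((tendsto_inv_atTop_zero.const_mul y₀).const_sub 1).smul_const c
  rw [mul_zero, sub_zero, one_smul] at h
  refine h.congr' ?_
  filter_upwards [eventually_gt_atTop 0] with Y hY
  rw [intervalIntegral.integral_const, smul_smul]
  congr 1
  field_simp

theorem integral_fourier_unitAddCircle {n : ℤ} (hn : n ≠ 0) :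
    ∫ x : UnitAddCircle, fourier n x = 0 := by
  rw [← UnitAddCircle.intervalIntegral_preimage 0]
  have hc : 2 * π * Complex.I * n ≠ 0 := by
    simp [hn, Real.pi_ne_zero]
  have h (x : ℝ) : fourier n (x : UnitAddCircle) = Complex.exp (2 * π * Complex.I * n * x) := by
    rw [fourier_coe_apply]; simp
  simp_rw [h]
  rw [integral_exp_mul_complex hc]
  have : 2 * π * Complex.I * n = n * (2 * π * Complex.I) := by ring
  simp [this, Complex.exp_int_mul_two_pi_mul_I]

theorem volume_real_univ_unitAddTorus {d : Type*} [Fintype d] :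
    (volume : Measure (UnitAddTorus d)).real Set.univ = 1 := by
  rw [Measure.real, volume_pi, Measure.pi_univ]
  simp [AddCircle.measure_univ]

/-- The integral of a character over the torus is `1` for the trivial character, else `0`. -/
theorem integral_mFourier {d : Type*} [Fintype d] (n : d → ℤ) [Decidable (n = 0)] :
    ∫ x : UnitAddTorus d, UnitAddTorus.mFourier n x = if n = 0 then 1 else 0 := by
  split_ifs with h
  · subst h
    simp [UnitAddTorus.mFourier_zero, volume_real_univ_unitAddTorus]
  · obtain ⟨i, hi⟩ := Function.ne_iff.1 h
    simp only [UnitAddTorus.mFourier, ContinuousMap.coe_mk]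
    rw [integral_fintype_prod_volume_eq_prod (f := fun i (x : UnitAddCircle) => fourier (n i) x)]
    exact Finset.prod_eq_zero (Finset.mem_univ i) (integral_fourier_unitAddCircle hi)

/-- Means along the half-line are contractions for the sup norm. -/
theorem norm_mean_le {y₀ : ℝ} (hy₀ : 0 ≤ y₀) {Y : ℝ} (hY : y₀ < Y) {f : ℝ → ℂ} {K : ℝ}
    (hK : ∀ y, ‖f y‖ ≤ K) : ‖(1 / Y : ℝ) • ∫ y in y₀..Y, f y‖ ≤ K := by
  have hY0 : 0 < Y := hy₀.trans_lt hY
  have hK0 : 0 ≤ K := (norm_nonneg _).trans (hK 0)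
  have h := intervalIntegral.norm_integral_le_of_norm_le_const
    (a := y₀) (b := Y) (f := f) (C := K) fun x _ => hK x
  rw [abs_of_pos (sub_pos.2 hY)] at h
  rw [norm_smul, Real.norm_of_nonneg (by positivity), one_div, inv_mul_le_iff₀ hY0]
  nlinarith

/-- The linear flow on the torus with frequencies `s j / (2π)`. -/
noncomputable def torusFlow {d : Type*} (s : d → ℝ) (y : ℝ) : UnitAddTorus d :=
  fun j => ((s j * y / (2 * π) : ℝ) : UnitAddCircle)

theorem continuous_torusFlow {d : Type*} (s : d → ℝ) : Continuous (torusFlow s) :=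
  continuous_pi fun j => (AddCircle.continuous_mk' 1).comp (by fun_prop)

theorem fourier_torusFlow {d : Type*} (s : d → ℝ) (y : ℝ) (j : d) (k : ℤ) :
    fourier k (torusFlow s y j) = Complex.exp (Complex.I * (k * s j : ℝ) * y) := by
  rw [torusFlow, fourier_coe_apply]
  have : (π : ℂ) ≠ 0 := by exact_mod_cast Real.pi_ne_zero
  congr 1
  push_cast
  field_simp

/-- Kronecker–Weyl: a linear flow with rationally independent frequencies equidistributes. -/
theorem tendsto_mean_torusFlow {d : Type*} [Fintype d] {s : d → ℝ} (hs : LinearIndependent ℚ s)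
    {y₀ : ℝ} (hy₀ : 0 ≤ y₀) (F : C(UnitAddTorus d, ℂ)) :
    Tendsto (fun Y : ℝ => (1 / Y : ℝ) • ∫ y in y₀..Y, F (torusFlow s y))
      atTop (𝓝 (∫ x, F x)) := by
  classical
  have hflow (G : C(UnitAddTorus d, ℂ)) (u v : ℝ) :
      IntervalIntegrable (fun y => G (torusFlow s y)) volume u v :=
    (G.continuous.comp (continuous_torusFlow s)).intervalIntegrable _ _
  have hfun (G : C(UnitAddTorus d, ℂ)) : Integrable (fun x => G x) :=
    G.continuous.integrable_of_hasCompactSupport (HasCompactSupport.of_compactSpace _)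
  have hspan : ∀ G ∈ Submodule.span ℂ (Set.range (UnitAddTorus.mFourier (d := d))),
      Tendsto (fun Y : ℝ => (1 / Y : ℝ) • ∫ y in y₀..Y, G (torusFlow s y))
        atTop (𝓝 (∫ x, G x)) := by
    intro G hG
    induction hG using Submodule.span_induction with
    | mem G hG =>
      obtain ⟨n, rfl⟩ := hG
      rw [integral_mFourier]
      split_ifs with hn
      · subst hn
        simpa only [UnitAddTorus.mFourier_zero, ContinuousMap.one_apply]
          using tendsto_mean_const y₀ 1
      · have hω : ∑ j, n j * s j ≠ 0 := by
          intro h0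
          refine hn (funext fun j => ?_)
          have := Fintype.linearIndependent_iff.1 hs (fun j => (n j : ℚ))
            (by simpa [Rat.smul_def] using h0) j
          exact_mod_cast this
        refine (tendsto_mean_exp_mul_I_zero hω y₀).congr fun Y => ?_
        congr 1
        refine intervalIntegral.integral_congr fun y _ => ?_
        simp only [UnitAddTorus.mFourier, ContinuousMap.coe_mk, fourier_torusFlow]
        rw [← Complex.exp_sum]
        push_cast
        rw [Finset.mul_sum, Finset.sum_mul]
    | zero => simp
    | add G H _ _ hG hH =>
      simp only [ContinuousMap.add_apply]
      rw [integral_add (hfun G) (hfun H)]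
      refine (hG.add hH).congr fun Y => ?_
      rw [intervalIntegral.integral_add (hflow G _ _) (hflow H _ _), smul_add]
    | smul c G _ hG =>
      simp only [ContinuousMap.smul_apply]
      rw [integral_smul]
      refine (hG.const_smul c).congr fun Y => ?_
      rw [intervalIntegral.integral_smul, smul_comm]
  have hF : F ∈ closure (Submodule.span ℂ (Set.range (UnitAddTorus.mFourier (d := d))) : Set _) := by
    rw [← Submodule.topologicalClosure_coe, UnitAddTorus.span_mFourier_closure_eq_top]
    trivial
  rw [Metric.tendsto_nhds]
  intro ε hε
  obtain ⟨G, hG, hFG⟩ := Metric.mem_closure_iff.1 hF (ε / 3) (by positivity)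
  have hb (x : UnitAddTorus d) : ‖F x - G x‖ ≤ ε / 3 := by
    rw [← dist_eq_norm]
    exact (ContinuousMap.dist_apply_le_dist x).trans hFG.le
  have hI : ‖(∫ x, F x) - ∫ x, G x‖ ≤ ε / 3 := by
    rw [← integral_sub (hfun F) (hfun G)]
    simpa [volume_real_univ_unitAddTorus] using norm_integral_le_of_norm_le_const
      (μ := (volume : Measure (UnitAddTorus d)))
      (.of_forall hb)
  filter_upwards [Metric.tendsto_nhds.1 (hspan G hG) (ε / 3) (by positivity),
    eventually_gt_atTop y₀] with Y hY hY₀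
  have hm := norm_mean_le hy₀ hY₀ (f := fun y => F (torusFlow s y) - G (torusFlow s y))
    fun y => hb _
  rw [intervalIntegral.integral_sub (hflow F _ _) (hflow G _ _), smul_sub] at hm
  rw [dist_eq_norm] at hY ⊢
  rw [norm_sub_rev] at hI
  have h3 := norm_add₃_le.trans_lt (add_lt_add_of_lt_of_le (add_lt_add_of_le_of_lt hm hY) hI)
  rwa [sub_add_sub_cancel, sub_add_sub_cancel, add_thirds] at h3

/-- The characteristic function of `2 Re (a z)`, with `z` uniform on the unit circle. -/
theorem integral_exp_re_mul_fourier (ξ : ℝ) (a : ℂ) :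
    ∫ x : UnitAddCircle, Complex.exp (-(Complex.I * ξ * (2 * (a * fourier 1 x).re : ℝ)))
      = ((1 / π * ∫ t in (0 : ℝ)..π, Real.cos (2 * ξ * ‖a‖ * Real.cos t) : ℝ) : ℂ) := by
  set g : ℝ → ℂ := fun u => Complex.exp (-(Complex.I * ξ * (2 * (‖a‖ * Real.cos u) : ℝ))) with hg
  have hgc : Continuous g := by fun_prop
  have hper : Function.Periodic g (2 * π) := fun u => by simp only [hg, Real.cos_add_two_pi]
  have hpt (t : ℝ) : Complex.exp (-(Complex.I * ξ *
      (2 * (a * fourier 1 (t : UnitAddCircle)).re : ℝ))) = g (2 * π * t + a.arg) := by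
    have h : a * fourier 1 (t : UnitAddCircle)
        = ‖a‖ * Complex.exp ((2 * π * t + a.arg : ℝ) * Complex.I) := by
      rw [fourier_coe_apply]
      conv_lhs => rw [← Complex.norm_mul_exp_arg_mul_I a]
      rw [mul_assoc, ← Complex.exp_add]
      congr 2
      push_cast
      ring
    rw [h, Complex.re_ofReal_mul, Complex.exp_ofReal_mul_I_re]
  have hfold : ∫ u in a.arg..(a.arg + 2 * π), g u
      = ∫ u in (0 : ℝ)..π, (2 * Real.cos (2 * ξ * ‖a‖ * Real.cos u) : ℝ) := by
    have hshift : ∫ u in (-π)..0, g u = ∫ u in (0 : ℝ)..π, g (u - π) := by simp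
    rw [hper.intervalIntegral_add_eq _ (-π), show -π + 2 * π = π by ring,
      ← intervalIntegral.integral_add_adjacent_intervals (hgc.intervalIntegrable _ 0)
        (hgc.intervalIntegrable _ _), hshift, ← intervalIntegral.integral_ofReal,
      ← intervalIntegral.integral_add
        (Continuous.intervalIntegrable (by fun_prop) _ _)
        (hgc.intervalIntegrable _ _)]
    refine intervalIntegral.integral_congr fun u _ => ?_
    simp only [hg, Real.cos_sub_pi]
    push_cast
    rw [Complex.two_cos]
    congr 2 <;> ring
  rw [← UnitAddCircle.intervalIntegral_preimage 0]
  simp_rw [hpt]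
  rw [intervalIntegral.integral_comp_mul_add g (by positivity),
    show 2 * π * 0 + a.arg = a.arg by ring,
    show 2 * π * (0 + 1) + a.arg = a.arg + 2 * π by ring, hfold,
    intervalIntegral.integral_const_mul, Complex.real_smul, ← Complex.ofReal_mul]
  congr 1
  field_simp

/-- The mean of `exp (-iξ T)` for a finite trigonometric sum `T` with independent frequencies. -/
theorem tendsto_mean_exp_trigSum {s : ℕ → ℝ} (hs : LinearIndependent ℚ s) (a : ℕ → ℂ)
    (b : ℝ) {y₀ : ℝ} (hy₀ : 0 ≤ y₀) (ξ : ℝ) (n : ℕ) :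
    Tendsto (fun Y : ℝ => (1 / Y : ℝ) • ∫ y in y₀..Y, Complex.exp (-(Complex.I * ξ *
        (2 * ∑ j ∈ Finset.range n, (a j * Complex.exp (Complex.I * s j * y)).re + b : ℝ))))
      atTop (𝓝 (Complex.exp (-(Complex.I * ξ * b)) *
        ((∏ j ∈ Finset.range n,
          (1 / π * ∫ t in (0 : ℝ)..π, Real.cos (2 * ξ * ‖a j‖ * Real.cos t)) : ℝ) : ℂ))) := by
  let G : Fin n → UnitAddCircle → ℂ := fun j x =>
    Complex.exp (-(Complex.I * ξ * (2 * (a j * fourier 1 x).re : ℝ)))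
  let F : C(UnitAddTorus (Fin n), ℂ) := ⟨fun x => ∏ j, G j (x j), by fun_prop⟩
  have h := (tendsto_mean_torusFlow (hs.comp (fun j : Fin n => (j : ℕ)) Fin.val_injective)
    hy₀ F).const_mul (Complex.exp (-(Complex.I * ξ * b)))
  have hF : ∫ x, F x = ((∏ j ∈ Finset.range n,
      (1 / π * ∫ t in (0 : ℝ)..π, Real.cos (2 * ξ * ‖a j‖ * Real.cos t)) : ℝ) : ℂ) := by
    simp only [F, ContinuousMap.coe_mk]
    rw [integral_fintype_prod_volume_eq_prod (f := G), Complex.ofReal_prod, Finset.prod_range]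
    exact Finset.prod_congr rfl fun j _ => integral_exp_re_mul_fourier ξ (a j)
  rw [hF] at h
  refine h.congr fun Y => ?_
  rw [mul_smul_comm, ← intervalIntegral.integral_const_mul]
  congr 1
  refine intervalIntegral.integral_congr fun y _ => ?_
  simp only [F, G, ContinuousMap.coe_mk, fourier_torusFlow, Function.comp_apply, Int.cast_one,
    one_mul]
  rw [← Complex.exp_sum, ← Complex.exp_add, Finset.sum_range]
  congr 1
  push_cast
  rw [Finset.sum_neg_distrib, ← Finset.mul_sum, ← Finset.mul_sum]
  ring

/-- If `f` and `g` differ by an exponentially decaying term plus a constant `δ`, so do the limits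
of their means. -/
theorem norm_sub_le_of_tendsto_mean {f g : ℝ → ℂ} {y₀ K δ : ℝ} (hy₀ : 0 ≤ y₀) (hK : 0 ≤ K)
    (hδ : 0 ≤ δ) (hf : ∀ Y, IntervalIntegrable f volume y₀ Y)
    (hg : ∀ Y, IntervalIntegrable g volume y₀ Y)
    (hfg : ∀ y, y₀ ≤ y → ‖f y - g y‖ ≤ K * Real.exp (-(y / 2)) + δ) {L M : ℂ}
    (hL : Tendsto (fun Y : ℝ => (1 / Y : ℝ) • ∫ y in y₀..Y, f y) atTop (𝓝 L))
    (hM : Tendsto (fun Y : ℝ => (1 / Y : ℝ) • ∫ y in y₀..Y, g y) atTop (𝓝 M)) :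
    ‖L - M‖ ≤ δ := by
  have hlim : Tendsto (fun Y : ℝ => 2 * K * Y⁻¹ + δ) atTop (𝓝 (2 * K * 0 + δ)) :=
    (tendsto_inv_atTop_zero.const_mul (2 * K)).add_const δ
  rw [mul_zero, zero_add] at hlim
  refine le_of_tendsto_of_tendsto (hL.sub hM).norm hlim ?_
  filter_upwards [eventually_gt_atTop y₀] with Y hY
  have hY0 : 0 < Y := hy₀.trans_lt hY
  have hcont : Continuous fun y : ℝ => K * Real.exp (-(y / 2)) + δ := by fun_prop
  have hbd := intervalIntegral.norm_integral_le_of_norm_le hY.le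
    (.of_forall fun y hy => hfg y hy.1.le) (hcont.intervalIntegrable (μ := volume) y₀ Y)
  have hder (y : ℝ) : HasDerivAt (fun y : ℝ => -2 * K * Real.exp (-(y / 2)) + δ * y)
      (K * Real.exp (-(y / 2)) + δ) y := by
    have h1 : HasDerivAt (fun y : ℝ => -(y / 2)) (-(1 / 2)) y :=
      ((hasDerivAt_id y).div_const 2).neg
    exact ((h1.exp.const_mul (-2 * K)).add ((hasDerivAt_id y).const_mul δ)).congr_deriv (by ring)
  rw [intervalIntegral.integral_eq_sub_of_hasDerivAt (fun y _ => hder y)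
    (hcont.intervalIntegrable _ _), intervalIntegral.integral_sub (hf Y) (hg Y)] at hbd
  have he : Real.exp (-(y₀ / 2)) ≤ 1 := Real.exp_le_one_iff.2 (by linarith)
  have he' := Real.exp_pos (-(Y / 2))
  rw [← smul_sub, norm_smul, Real.norm_of_nonneg (by positivity), one_div,
    inv_mul_le_iff₀ hY0]
  have : Y * (2 * K * Y⁻¹ + δ) = 2 * K + δ * Y := by field_simp
  rw [this]
  nlinarith [mul_nonneg hK he'.le, mul_nonneg hδ hy₀, mul_le_mul_of_nonneg_left he hK]

/-- With `(s_j)` nonzero reals linearly independent over `ℚ`,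
`∑|a_j| < ∞`, `b ∈ ℝ`, `y₀ ≥ 0`, `C ≥ 0`, and `E` measurable with
`|E(y) - (2 ∑_j Re(a_j e^{i s_j y}) + b)| ≤ C e^{-y/2}` for `y ≥ y₀`: every Borel
probability measure `μ` with `(1/Y)∫_{y₀}^Y h(E(y)) dy → ∫ h dμ` for all Lipschitz `h`
satisfies, for every `ξ ∈ ℝ`:  the partial products
`∏_{j<n} (1/π) ∫_0^π cos(2ξ|a_j| cos t) dt` converge to some `P`, and
`∫ e^{-iξx} dμ(x) = e^{-iξb} · P`. -/
theorem stmt_10 (s : ℕ → ℝ) (hs : ∀ j, s j ≠ 0) (hsli : LinearIndependent ℚ s)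
    (a : ℕ → ℂ) (ha : Summable fun j => ‖a j‖) (b y₀ C : ℝ) (hy₀ : 0 ≤ y₀) (hC : 0 ≤ C)
    (E : ℝ → ℝ) (hE : Measurable E)
    (hEapprox : ∀ y : ℝ, y₀ ≤ y →
      |E y - (2 * ∑' j : ℕ, (a j * Complex.exp (Complex.I * (s j : ℂ) * (y : ℂ))).re + b)|
        ≤ C * Real.exp (-(y / 2)))
    (μ : Measure ℝ) (hμ : IsProbabilityMeasure μ)
    (hlim : ∀ (h : ℝ → ℂ), (∃ k : NNReal, LipschitzWith k h) →
      Filter.Tendsto (fun Y : ℝ => (1 / Y : ℝ) • ∫ y in y₀..Y, h (E y))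
        Filter.atTop (nhds (∫ x : ℝ, h x ∂μ))) :
    ∀ ξ : ℝ, ∃ P : ℝ,
      Filter.Tendsto (fun n : ℕ => ∏ j ∈ Finset.range n,
          (1 / Real.pi) * ∫ t in (0 : ℝ)..Real.pi, Real.cos (2 * ξ * ‖a j‖ * Real.cos t))
        Filter.atTop (nhds P) ∧
      (∫ x : ℝ, Complex.exp (-(Complex.I * (ξ : ℂ) * (x : ℂ))) ∂μ)
        = Complex.exp (-(Complex.I * (ξ : ℂ) * (b : ℂ))) * (P : ℂ) := by
  intro ξ
  set φ : ℝ → ℂ := fun x => Complex.exp (-(Complex.I * ξ * x)) with hφ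
  have hφc : Continuous φ := by fun_prop
  have hφn (x : ℝ) : ‖φ x‖ = 1 := by
    simp only [hφ]
    rw [show -(Complex.I * ξ * x) = ((-(ξ * x) : ℝ) : ℂ) * Complex.I by push_cast; ring,
      Complex.norm_exp_ofReal_mul_I]
  set p : ℕ → ℝ := fun n => ∏ j ∈ Finset.range n,
    (1 / Real.pi) * ∫ t in (0 : ℝ)..Real.pi, Real.cos (2 * ξ * ‖a j‖ * Real.cos t)
  set L : ℂ := ∫ x : ℝ, φ x ∂μ
  have hL := hlim φ ⟨‖ξ‖₊, LipschitzWith.of_dist_le_mul fun x y => by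
    simpa [dist_eq_norm] using norm_exp_neg_I_mul_sub_le ξ x y⟩
  have hre (y : ℝ) (j : ℕ) :
      ‖(a j * Complex.exp (Complex.I * (s j : ℂ) * (y : ℂ))).re‖ ≤ ‖a j‖ := by
    refine (Complex.abs_re_le_norm _).trans_eq ?_
    rw [norm_mul, show Complex.I * (s j : ℂ) * (y : ℂ) = ((s j * y : ℝ) : ℂ) * Complex.I by
      push_cast; ring, Complex.norm_exp_ofReal_mul_I, mul_one]
  have hbound (n : ℕ) : ‖L - φ b * (p n : ℂ)‖ ≤ |ξ| * (2 * ∑' j, ‖a (j + n)‖) := by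
    set T : ℝ → ℝ := fun y =>
      2 * ∑ j ∈ Finset.range n, (a j * Complex.exp (Complex.I * s j * y)).re + b with hT
    have hTc : Continuous T := by fun_prop
    have htail : 0 ≤ ∑' j, ‖a (j + n)‖ := tsum_nonneg fun _ => norm_nonneg _
    refine norm_sub_le_of_tendsto_mean (K := |ξ| * C) (f := fun y => φ (E y))
      (g := fun y => φ (T y)) hy₀ (by positivity) (by positivity) (fun Y => ?_)
      (fun Y => (hφc.comp hTc).intervalIntegrable _ _) (fun y hy => ?_) hL
      (tendsto_mean_exp_trigSum hsli a b hy₀ ξ n)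
    · refine (intervalIntegrable_const (c := (1 : ℝ))).mono_fun
        (hφc.measurable.comp hE).aestronglyMeasurable (.of_forall fun y => ?_)
      simp [hφn]
    · refine (norm_exp_neg_I_mul_sub_le ξ (E y) (T y)).trans ?_
      have hsum : Summable fun j => (a j * Complex.exp (Complex.I * (s j : ℂ) * (y : ℂ))).re :=
        ha.of_norm_bounded (hre y)
      have hsplit := hsum.sum_add_tsum_nat_add n
      have hle := tsum_of_norm_bounded ((summable_nat_add_iff n).2 ha).hasSum
        fun j => hre y (j + n)
      have hEy := hEapprox y hy
      rw [← hsplit] at hEy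
      rw [Real.norm_eq_abs, abs_le] at hle
      rw [abs_le] at hEy
      rw [mul_assoc, ← mul_add]
      refine mul_le_mul_of_nonneg_left (abs_le.2 ?_) (abs_nonneg ξ)
      simp only [hT]
      constructor <;> linarith
  have hconv : Tendsto (fun n => φ b * (p n : ℂ)) atTop (𝓝 L) := by
    rw [tendsto_iff_norm_sub_tendsto_zero]
    have h0 := ((tendsto_sum_nat_add fun j => ‖a j‖).const_mul 2).const_mul |ξ|
    rw [mul_zero, mul_zero] at h0
    refine squeeze_zero (fun _ => norm_nonneg _) (fun n => ?_) h0
    rw [norm_sub_rev]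
    exact hbound n
  have hφb : φ b ≠ 0 := Complex.exp_ne_zero _
  have hpc : Tendsto (fun n => (p n : ℂ)) atTop (𝓝 ((φ b)⁻¹ * L)) :=
    (hconv.const_mul (φ b)⁻¹).congr fun n => inv_mul_cancel_left₀ hφb _
  have hpr : Tendsto p atTop (𝓝 ((φ b)⁻¹ * L).re) :=
    ((Complex.continuous_re.tendsto _).comp hpc).congr fun n => Complex.ofReal_re _
  refine ⟨((φ b)⁻¹ * L).re, hpr, ?_⟩
  exact tendsto_nhds_unique hconv
    (((Complex.continuous_ofReal.tendsto _).comp hpr).const_mul (φ b))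
end

section
/- Let (s_j)_{j∈ℕ} be nonzero real numbers that are linearly independent over ℚ (every finite subfamily is ℚ-linearly independent), let (a_j)_{j∈ℕ} be complex numbers with ∑_j |a_j| < ∞, b ∈ ℝ, y₀ ≥ 0, C ≥ 0, and let E : [y₀, ∞) → ℝ be measurable with |E(y) − (2 ∑_{j} Re(a_j e^{i s_j y}) + b)| ≤ C e^{−y/2} for all y ≥ y₀. Then every Borel probability measure μ on ℝ satisfying lim_{Y→∞} (1/Y) ∫_{y₀}^Y h(E(y)) dy = ∫_ℝ h dμ for all Lipschitz h : ℝ → ℂ is symmetric about b: the pushforward of μ under the map x ↦ 2b − x equals μ. -/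
open MeasureTheory Real

open Filter Topology
open scoped BoundedContinuousFunction ComplexConjugate

/-- The time average of `f` over `[y₀, Y]` tends to `0` as `Y → ∞`. -/
def HasZeroMean (y₀ : ℝ) (f : ℝ → ℂ) : Prop :=
  Tendsto (fun Y : ℝ => (1 / Y : ℝ) • ∫ y in y₀..Y, f y) atTop (𝓝 0)

theorem HasZeroMean.of_norm_integral_le {y₀ : ℝ} {f : ℝ → ℂ} (K : ℝ)
    (h : ∀ Y, y₀ ≤ Y → ‖∫ y in y₀..Y, f y‖ ≤ K) : HasZeroMean y₀ f := by
  have hK : Tendsto (fun Y : ℝ => K / Y) atTop (𝓝 0) := tendsto_const_nhds.div_atTop tendsto_id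
  refine squeeze_zero_norm' ?_ hK
  filter_upwards [eventually_ge_atTop y₀, eventually_gt_atTop 0] with Y hY hY0
  rw [norm_smul, Real.norm_of_nonneg (by positivity), one_div_mul_eq_div]
  gcongr
  exact h Y hY

theorem HasZeroMean.of_norm_le_exp {y₀ : ℝ} {f : ℝ → ℂ} (K : ℝ)
    (h : ∀ y, y₀ ≤ y → ‖f y‖ ≤ K * Real.exp (-(y / 2))) : HasZeroMean y₀ f := by
  have hK : 0 ≤ K := by
    have := (norm_nonneg _).trans (h y₀ le_rfl)
    exact nonneg_of_mul_nonneg_left this (Real.exp_pos _)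
  refine .of_norm_integral_le (K * (2 * Real.exp (-(y₀ / 2)))) fun Y hY => ?_
  have hd (y : ℝ) : HasDerivAt (fun y => K * (-2 * Real.exp (-(y / 2))))
      (K * Real.exp (-(y / 2))) y := by
    refine (((((hasDerivAt_id y).div_const 2).neg.exp).const_mul (-2)).const_mul K).congr_deriv ?_
    simp only [Pi.neg_apply, id_eq]
    ring
  have hi : IntervalIntegrable (fun y => K * Real.exp (-(y / 2))) volume y₀ Y :=
    Continuous.intervalIntegrable (by fun_prop) _ _
  calc ‖∫ y in y₀..Y, f y‖
      ≤ ∫ y in y₀..Y, K * Real.exp (-(y / 2)) :=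
        intervalIntegral.norm_integral_le_of_norm_le hY
          (Eventually.of_forall fun y hy => h y hy.1.le) hi
    _ = K * (-2 * Real.exp (-(Y / 2))) - K * (-2 * Real.exp (-(y₀ / 2))) :=
        intervalIntegral.integral_eq_sub_of_hasDerivAt (fun y _ => hd y) hi
    _ ≤ K * (2 * Real.exp (-(y₀ / 2))) := by
        nlinarith [mul_nonneg hK (Real.exp_pos (-(Y / 2))).le]

theorem HasZeroMean.add {y₀ : ℝ} {f g : ℝ → ℂ} (hf : HasZeroMean y₀ f) (hg : HasZeroMean y₀ g)
    (hfi : ∀ Y, IntervalIntegrable f volume y₀ Y) (hgi : ∀ Y, IntervalIntegrable g volume y₀ Y) :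
    HasZeroMean y₀ fun y => f y + g y := by
  unfold HasZeroMean
  simpa [intervalIntegral.integral_add (hfi _) (hgi _)] using Tendsto.add hf hg

theorem HasZeroMean.const_mul {y₀ : ℝ} {f : ℝ → ℂ} (hf : HasZeroMean y₀ f) (c : ℂ) :
    HasZeroMean y₀ fun y => c * f y := by
  unfold HasZeroMean
  simpa [mul_left_comm] using Tendsto.const_mul c hf

/-- Bounded continuous functions with mean zero. -/
def zeroMeanSubmodule (y₀ : ℝ) : Submodule ℂ (ℝ →ᵇ ℂ) where
  carrier := {f | HasZeroMean y₀ f}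
  add_mem' {f g} hf hg := HasZeroMean.add hf hg
    (fun _ => f.continuous.intervalIntegrable _ _) (fun _ => g.continuous.intervalIntegrable _ _)
  zero_mem' := by simp [HasZeroMean]
  smul_mem' c f hf := HasZeroMean.const_mul hf c

theorem isClosed_zeroMeanSubmodule {y₀ : ℝ} (hy₀ : 0 ≤ y₀) :
    IsClosed (zeroMeanSubmodule y₀ : Set (ℝ →ᵇ ℂ)) := by
  refine isClosed_of_closure_subset fun f hf => ?_
  refine Metric.tendsto_nhds.2 fun ε hε => ?_
  obtain ⟨g, hg, hfg⟩ := Metric.mem_closure_iff.1 hf (ε / 2) (half_pos hε)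
  filter_upwards [Metric.tendsto_nhds.1 (show HasZeroMean y₀ g from hg) (ε / 2) (half_pos hε),
    eventually_ge_atTop y₀, eventually_gt_atTop 0] with Y hgY hY hY0
  rw [dist_zero_right] at hgY ⊢
  have hsplit : ∫ y in y₀..Y, f y = (∫ y in y₀..Y, (f y - g y)) + ∫ y in y₀..Y, g y := by
    rw [intervalIntegral.integral_sub (f.continuous.intervalIntegrable _ _)
      (g.continuous.intervalIntegrable _ _), sub_add_cancel]
  have hdiff : ‖(1 / Y : ℝ) • ∫ y in y₀..Y, (f y - g y)‖ ≤ ε / 2 := by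
    rw [norm_smul, Real.norm_of_nonneg (by positivity), one_div_mul_eq_div, div_le_iff₀ hY0]
    calc ‖∫ y in y₀..Y, (f y - g y)‖ ≤ ε / 2 * |Y - y₀| :=
          intervalIntegral.norm_integral_le_of_norm_le_const fun y _ => by
            rw [← dist_eq_norm]
            exact (BoundedContinuousFunction.dist_coe_le_dist y).trans hfg.le
      _ ≤ ε / 2 * Y := by
          rw [abs_of_nonneg (by linarith)]
          gcongr
          linarith
  rw [hsplit, smul_add]
  linarith [norm_add_le ((1 / Y : ℝ) • ∫ y in y₀..Y, (f y - g y))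
    ((1 / Y : ℝ) • ∫ y in y₀..Y, g y)]

/-- The wave `y ↦ e^{i (w y + c)}` of frequency `w` and phase `c`. -/
noncomputable def wave (w c : ℝ) : ℝ →ᵇ ℂ :=
  BoundedContinuousFunction.ofNormedAddCommGroup
    (fun y : ℝ => Complex.exp (((w * y + c : ℝ) : ℂ) * Complex.I)) (by fun_prop) 1
    fun y => (Complex.norm_exp_ofReal_mul_I _).le

theorem wave_apply (w c y : ℝ) :
    wave w c y = Complex.exp (((w * y + c : ℝ) : ℂ) * Complex.I) := rfl

theorem norm_wave_le (w c : ℝ) : ‖wave w c‖ ≤ 1 :=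
  BoundedContinuousFunction.norm_ofNormedAddCommGroup_le _ zero_le_one _

theorem wave_zero : wave 0 0 = 1 := by
  ext y
  simp [wave_apply]

theorem wave_add (w w' c c' : ℝ) : wave (w + w') (c + c') = wave w c * wave w' c' := by
  ext y
  rw [BoundedContinuousFunction.mul_apply, wave_apply, wave_apply, wave_apply, ← Complex.exp_add]
  congr 1
  push_cast
  ring

theorem wave_mem_zeroMeanSubmodule (y₀ : ℝ) {w : ℝ} (hw : w ≠ 0) (c : ℝ) :
    wave w c ∈ zeroMeanSubmodule y₀ := by
  refine HasZeroMean.of_norm_integral_le (2 / |w|) fun Y _ => ?_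
  have hwI : (w : ℂ) * Complex.I ≠ 0 := by simp [hw]
  have hd (y : ℝ) : HasDerivAt (fun y : ℝ => wave w c y / (w * Complex.I)) (wave w c y) y := by
    have h1 : HasDerivAt (fun y : ℝ => ((w * y + c : ℝ) : ℂ) * Complex.I) (w * Complex.I) y := by
      have := ((((hasDerivAt_id y).const_mul w).add_const c).ofReal_comp).mul_const Complex.I
      simpa using this
    have h2 := h1.cexp.div_const (w * Complex.I)
    rwa [mul_div_assoc, div_self hwI, mul_one] at h2
  rw [intervalIntegral.integral_eq_sub_of_hasDerivAt (fun y _ => hd y)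
    ((wave w c).continuous.intervalIntegrable _ _), ← sub_div, norm_div]
  have hn : ‖(w : ℂ) * Complex.I‖ = |w| := by simp
  rw [hn]
  gcongr
  refine (norm_sub_le _ _).trans ?_
  simp only [wave_apply, Complex.norm_exp_ofReal_mul_I]
  norm_num

/-- The pair consisting of the wave of frequency `∑ v_j s_j` and of its multiple by
`(-1) ^ ∑ v_j`. -/
noncomputable def twistedWave (s : ℕ → ℝ) : Multiplicative (ℕ →₀ ℤ) →* (ℝ →ᵇ ℂ) × (ℝ →ᵇ ℂ) where
  toFun v :=
    (wave (Finsupp.linearCombination ℤ s v.toAdd) 0,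
      wave (Finsupp.linearCombination ℤ s v.toAdd)
        (Finsupp.linearCombination ℤ (fun _ : ℕ => π) v.toAdd))
  map_one' := by simp [wave_zero]
  map_mul' v w := by
    simp only [toAdd_mul, map_add, Prod.mk_mul_mk, ← wave_add, add_zero]

/-- The closed algebra generated by the twisted waves. -/
noncomputable def twistedAlgebra (s : ℕ → ℝ) : Subalgebra ℂ ((ℝ →ᵇ ℂ) × (ℝ →ᵇ ℂ)) :=
  (Algebra.adjoin ℂ (MonoidHom.mrange (twistedWave s) : Set _)).topologicalClosure

theorem twistedWave_mem (s : ℕ → ℝ) (v : Multiplicative (ℕ →₀ ℤ)) :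
    twistedWave s v ∈ twistedAlgebra s :=
  Subalgebra.le_topologicalClosure _ (Algebra.subset_adjoin ⟨v, rfl⟩)

theorem norm_twistedWave_le (s : ℕ → ℝ) (v : Multiplicative (ℕ →₀ ℤ)) :
    ‖twistedWave s v‖ ≤ 1 :=
  max_le (norm_wave_le _ _) (norm_wave_le _ _)

theorem fst_sub_snd_mem_of_mem_twistedAlgebra {y₀ : ℝ} (hy₀ : 0 ≤ y₀) {s : ℕ → ℝ}
    (hs : LinearIndependent ℤ s) {p : (ℝ →ᵇ ℂ) × (ℝ →ᵇ ℂ)} (hp : p ∈ twistedAlgebra s) :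
    p.1 - p.2 ∈ zeroMeanSubmodule y₀ := by
  let L : Submodule ℂ ((ℝ →ᵇ ℂ) × (ℝ →ᵇ ℂ)) :=
    (zeroMeanSubmodule y₀).comap (LinearMap.fst ℂ _ _ - LinearMap.snd ℂ _ _)
  have hL : IsClosed (L : Set ((ℝ →ᵇ ℂ) × (ℝ →ᵇ ℂ))) :=
    (isClosed_zeroMeanSubmodule hy₀).preimage (continuous_fst.sub continuous_snd)
  have hle : (Algebra.adjoin ℂ (MonoidHom.mrange (twistedWave s) : Set _)).toSubmodule ≤ L := by
    rw [Algebra.adjoin_eq_span, Submonoid.closure_eq, Submodule.span_le]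
    rintro _ ⟨v, rfl⟩
    change wave _ _ - wave _ _ ∈ zeroMeanSubmodule y₀
    by_cases hv : Finsupp.linearCombination ℤ s v.toAdd = 0
    · have : v.toAdd = 0 := (linearIndependent_iff.1 hs) _ hv
      simp [this]
    · exact Submodule.sub_mem _ (wave_mem_zeroMeanSubmodule _ hv _)
        (wave_mem_zeroMeanSubmodule _ hv _)
  exact (closure_minimal (SetLike.coe_subset_coe.2 hle) hL :) hp

/-- The almost periodic function `y ↦ 2 ∑ Re (a_j e^{i s_j y})`. -/
noncomputable def waveSeries (s : ℕ → ℝ) (a : ℕ → ℂ) (y : ℝ) : ℝ :=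
  2 * ∑' j : ℕ, (a j * Complex.exp (Complex.I * (s j : ℂ) * (y : ℂ))).re

theorem summable_waveSeries (s : ℕ → ℝ) {a : ℕ → ℂ} (ha : Summable fun j => ‖a j‖) (y : ℝ) :
    Summable fun j => (a j * Complex.exp (Complex.I * (s j : ℂ) * (y : ℂ))).re := by
  refine ha.of_norm_bounded fun j => (Complex.abs_re_le_norm _).trans ?_
  rw [norm_mul, show Complex.I * (s j : ℂ) * y = Complex.I * ((s j * y : ℝ) : ℂ) by
    push_cast; ring, Complex.norm_exp_I_mul_ofReal, mul_one]

theorem exists_mem_twistedAlgebra_eq_waveSeries (s : ℕ → ℝ) {a : ℕ → ℂ}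
    (ha : Summable fun j => ‖a j‖) :
    ∃ p ∈ twistedAlgebra s, ∀ y, p.1 y = waveSeries s a y ∧ p.2 y = -waveSeries s a y := by
  let u (n : ℤ) (j : ℕ) := twistedWave s (.ofAdd (Finsupp.single j n))
  let q (j : ℕ) := a j • u 1 j + conj (a j) • u (-1) j
  have hq : Summable q := by
    refine .add (ha.of_norm_bounded fun j => ?_) (ha.of_norm_bounded fun j => ?_)
    · rw [norm_smul]
      exact mul_le_of_le_one_right (norm_nonneg _) (norm_twistedWave_le _ _)
    · rw [norm_smul, RCLike.norm_conj]
      exact mul_le_of_le_one_right (norm_nonneg _) (norm_twistedWave_le _ _)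
  have hterm (j : ℕ) (y : ℝ) :
      (q j).1 y = ((2 * (a j * Complex.exp (Complex.I * (s j : ℂ) * (y : ℂ))).re : ℝ) : ℂ) := by
    have hconj : conj (Complex.exp (Complex.I * s j * y)) =
        Complex.exp (-(s j * y * Complex.I)) := by
      rw [← Complex.exp_conj]
      congr 1
      simp
      ring
    rw [← Complex.add_conj, map_mul, hconj]
    simp [q, u, twistedWave, wave_apply, mul_assoc, mul_comm Complex.I]
  have hterm' (j : ℕ) (y : ℝ) : (q j).2 y = -(q j).1 y := by
    simp [q, u, twistedWave, wave_apply, add_mul, Complex.exp_add, Complex.exp_neg]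
    ring
  have hsum (y : ℝ) : HasSum (fun j => (q j).1 y) (waveSeries s a y) := by
    simp_rw [hterm]
    exact Complex.hasSum_ofReal.2 ((summable_waveSeries s ha y).hasSum.mul_left 2)
  refine ⟨∑' j, q j, ?_, fun y => ⟨?_, ?_⟩⟩
  · refine (Subalgebra.isClosed_topologicalClosure _).mem_of_tendsto hq.hasSum
      (Eventually.of_forall fun F => Subalgebra.sum_mem _ fun j _ => ?_)
    exact Subalgebra.add_mem _ (Subalgebra.smul_mem _ (twistedWave_mem _ _) _)
      (Subalgebra.smul_mem _ (twistedWave_mem _ _) _)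
  · have := hq.hasSum.mapL ((BoundedContinuousFunction.evalCLM ℂ y).comp
      (ContinuousLinearMap.fst ℂ (ℝ →ᵇ ℂ) (ℝ →ᵇ ℂ)))
    exact this.unique (hsum y)
  · have := hq.hasSum.mapL ((BoundedContinuousFunction.evalCLM ℂ y).comp
      (ContinuousLinearMap.snd ℂ (ℝ →ᵇ ℂ) (ℝ →ᵇ ℂ)))
    refine this.unique ?_
    simpa [hterm'] using (hsum y).neg

theorem BoundedContinuousFunction.exp_apply (f : ℝ →ᵇ ℂ) (y : ℝ) :
    NormedSpace.exp f y = Complex.exp (f y) := by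
  let : NormedAlgebra ℚ (ℝ →ᵇ ℂ) := .restrictScalars ℚ ℂ _
  let ev : (ℝ →ᵇ ℂ) →+* ℂ :=
    { toFun := fun f => f y
      map_one' := rfl
      map_mul' := fun _ _ => rfl
      map_zero' := rfl
      map_add' := fun _ _ => rfl }
  rw [Complex.exp_eq_exp_ℂ]
  exact NormedSpace.map_exp ev (BoundedContinuousFunction.evalCLM ℂ y).continuous f

theorem hasZeroMean_exp_sub_exp_neg {y₀ : ℝ} (hy₀ : 0 ≤ y₀) {s : ℕ → ℝ}
    (hs : LinearIndependent ℤ s) {a : ℕ → ℂ} (ha : Summable fun j => ‖a j‖) (t : ℝ) :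
    ∃ g : ℝ →ᵇ ℂ, HasZeroMean y₀ g ∧ ∀ y, g y =
      Complex.exp (t * waveSeries s a y * Complex.I) -
        Complex.exp (-(t * waveSeries s a y * Complex.I)) := by
  let : NormedAlgebra ℚ (ℝ →ᵇ ℂ) := .restrictScalars ℚ ℂ _
  let : NormedAlgebra ℚ ((ℝ →ᵇ ℂ) × (ℝ →ᵇ ℂ)) := .restrictScalars ℚ ℂ _
  obtain ⟨p, hp, hpy⟩ := exists_mem_twistedAlgebra_eq_waveSeries s ha
  have hmem : NormedSpace.exp (((t : ℂ) * Complex.I) • p) ∈ twistedAlgebra s :=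
    NormedSpace.exp_mem (s := twistedAlgebra s) (Subalgebra.isClosed_topologicalClosure _)
      (Subalgebra.smul_mem _ hp _)
  refine ⟨_, fst_sub_snd_mem_of_mem_twistedAlgebra hy₀ hs hmem, fun y => ?_⟩
  rw [Prod.fst_exp, Prod.snd_exp, BoundedContinuousFunction.sub_apply,
    BoundedContinuousFunction.exp_apply, BoundedContinuousFunction.exp_apply]
  simp only [Prod.smul_fst, Prod.smul_snd, BoundedContinuousFunction.smul_apply, hpy, smul_eq_mul]
  congr 2 <;> ring

theorem norm_exp_mul_I_sub_le (x y : ℝ) :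
    ‖Complex.exp (x * Complex.I) - Complex.exp (y * Complex.I)‖ ≤ |x - y| := by
  have h : Complex.exp (x * Complex.I) - Complex.exp (y * Complex.I) =
      Complex.exp (y * Complex.I) * (Complex.exp (Complex.I * ((x - y : ℝ) : ℂ)) - 1) := by
    rw [mul_sub, ← Complex.exp_add, mul_one]
    congr 2
    push_cast
    ring
  rw [h, norm_mul, Complex.norm_exp_ofReal_mul_I, one_mul]
  exact Real.norm_exp_I_mul_ofReal_sub_one_le

/-- With `(s_j)` nonzero reals linearly independent over `ℚ`,
`∑|a_j| < ∞`, `b ∈ ℝ`, `y₀ ≥ 0`, `C ≥ 0`, and `E` measurable with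
`|E(y) - (2 ∑_j Re(a_j e^{i s_j y}) + b)| ≤ C e^{-y/2}` for `y ≥ y₀`: every Borel
probability measure `μ` with `(1/Y)∫_{y₀}^Y h(E(y)) dy → ∫ h dμ` for all Lipschitz `h`
is symmetric about `b`, i.e. the pushforward of `μ` under `x ↦ 2b - x` equals `μ`. -/
theorem stmt_11 (s : ℕ → ℝ) (hs : ∀ j, s j ≠ 0) (hsli : LinearIndependent ℚ s)
    (a : ℕ → ℂ) (ha : Summable fun j => ‖a j‖) (b y₀ C : ℝ) (hy₀ : 0 ≤ y₀) (hC : 0 ≤ C)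
    (E : ℝ → ℝ) (hE : Measurable E)
    (hEapprox : ∀ y : ℝ, y₀ ≤ y →
      |E y - (2 * ∑' j : ℕ, (a j * Complex.exp (Complex.I * (s j : ℂ) * (y : ℂ))).re + b)|
        ≤ C * Real.exp (-(y / 2)))
    (μ : Measure ℝ) (hμ : IsProbabilityMeasure μ)
    (hlim : ∀ (h : ℝ → ℂ), (∃ k : NNReal, LipschitzWith k h) →
      Filter.Tendsto (fun Y : ℝ => (1 / Y : ℝ) • ∫ y in y₀..Y, h (E y))
        Filter.atTop (nhds (∫ x : ℝ, h x ∂μ))) :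
    μ.map (fun x : ℝ => 2 * b - x) = μ := by
  have hmap : Measurable fun x : ℝ => 2 * b - x := by fun_prop
  have : IsProbabilityMeasure (μ.map fun x : ℝ => 2 * b - x) :=
    Measure.isProbabilityMeasure_map hmap.aemeasurable
  refine Measure.ext_of_charFun (funext fun t => ?_)
  rw [charFun_apply_real, charFun_apply_real,
    integral_map hmap.aemeasurable (by fun_prop)]
  let h₁ (x : ℝ) : ℂ := Complex.exp (t * x * Complex.I)
  let h₂ (x : ℝ) : ℂ := Complex.exp (t * (2 * b - x : ℝ) * Complex.I)
  have hn₁ (x : ℝ) : ‖h₁ x‖ ≤ 1 := by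
    simpa [h₁] using (Complex.norm_exp_ofReal_mul_I (t * x)).le
  have hn₂ (x : ℝ) : ‖h₂ x‖ ≤ 1 := hn₁ _
  have hsub₁ (x y : ℝ) : ‖h₁ x - h₁ y‖ ≤ |t| * |x - y| := by
    rw [← abs_mul, mul_sub]
    simpa [h₁] using norm_exp_mul_I_sub_le (t * x) (t * y)
  have hsub₂ (x y : ℝ) : ‖h₂ x - h₂ y‖ ≤ |t| * |x - y| := by
    refine (hsub₁ _ _).trans_eq ?_
    rw [sub_sub_sub_cancel_left, abs_sub_comm]
  have hlip {h : ℝ → ℂ} (hh : ∀ x y, ‖h x - h y‖ ≤ |t| * |x - y|) :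
      ∃ k : NNReal, LipschitzWith k h :=
    ⟨⟨|t|, abs_nonneg t⟩, LipschitzWith.of_dist_le_mul fun x y => by
      rw [dist_eq_norm, Real.dist_eq]
      exact hh x y⟩
  have hint {h : ℝ → ℂ} (hh : Continuous h) (hn : ∀ x, ‖h x‖ ≤ 1) (Y : ℝ) :
      IntervalIntegrable (fun y => h (E y)) volume y₀ Y :=
    (intervalIntegrable_const (c := (1 : ℝ))).mono_fun
      (hh.measurable.comp hE).aestronglyMeasurable
      (Eventually.of_forall fun y => by simpa using hn (E y))
  have hint₁ := hint (h := h₁) (by fun_prop) hn₁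
  have hint₂ := hint (h := h₂) (by fun_prop) hn₂
  have hlim' := (hlim h₁ (hlip hsub₁)).sub (hlim h₂ (hlip hsub₂))
  obtain ⟨g, hg, hgy⟩ := hasZeroMean_exp_sub_exp_neg hy₀
    (hsli.restrict_scalars' ℤ) ha t
  let G (y : ℝ) : ℂ := Complex.exp (t * b * Complex.I) * g y
  have hGi (Y : ℝ) : IntervalIntegrable G volume y₀ Y :=
    Continuous.intervalIntegrable (continuous_const.mul g.continuous) _ _
  have hG (y : ℝ) : G y = h₁ (waveSeries s a y + b) - h₂ (waveSeries s a y + b) := by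
    simp only [G, h₁, h₂, hgy, mul_sub, ← Complex.exp_add]
    congr 2 <;> push_cast <;> ring
  have hr : HasZeroMean y₀ fun y => h₁ (E y) - h₂ (E y) - G y := by
    refine .of_norm_le_exp (2 * |t| * C) fun y hy => ?_
    have key := mul_le_mul_of_nonneg_left (hEapprox y hy) (abs_nonneg t)
    change |t| * |E y - (waveSeries s a y + b)| ≤ _ at key
    rw [hG, sub_sub_sub_comm]
    refine (norm_sub_le _ _).trans ?_
    linarith [hsub₁ (E y) (waveSeries s a y + b), hsub₂ (E y) (waveSeries s a y + b)]
  have hz : HasZeroMean y₀ fun y => h₁ (E y) - h₂ (E y) := by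
    have hGz : HasZeroMean y₀ G := hg.const_mul _
    simpa only [sub_add_cancel] using
      hr.add hGz (fun Y => ((hint₁ Y).sub (hint₂ Y)).sub (hGi Y)) hGi
  have hlim'' : Tendsto (fun Y : ℝ => (1 / Y : ℝ) • ∫ y in y₀..Y, (h₁ (E y) - h₂ (E y))) atTop
      (𝓝 ((∫ x, h₁ x ∂μ) - ∫ x, h₂ x ∂μ)) := by
    simpa only [intervalIntegral.integral_sub (hint₁ _) (hint₂ _), smul_sub] using hlim'
  exact (sub_eq_zero.1 (tendsto_nhds_unique hlim'' hz)).symm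
end

section
/- The ideal of ℤ[ζ] generated by 2 + ζ³ (that is, by 2 + i) is maximal, and the quotient ring ℤ[ζ]/(2 + ζ³) is a finite field with exactly 25 elements. -/
open Polynomial in
/-- An integer polynomial vanishing at a primitive `n`-th root of unity in a field of
characteristic zero is divisible by the `n`-th cyclotomic polynomial. -/
theorem IsPrimitiveRoot.cyclotomic_dvd_of_eval₂_eq_zero {K : Type*} [Field K]
    [CharZero K] {n : ℕ} {ζ : K} (hζ : IsPrimitiveRoot ζ n) (hn : 0 < n) {p : ℤ[X]}
    (hp : p.eval₂ (Int.castRingHom K) ζ = 0) : cyclotomic n ℤ ∣ p := by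
  rw [cyclotomic_eq_minpoly hζ hn]
  exact minpoly.isIntegrallyClosed_dvd (hζ.isIntegral hn) hp

open Polynomial in
/-- An integer polynomial vanishing at a primitive `n`-th root of unity in a domain of
characteristic zero is divisible by the `n`-th cyclotomic polynomial. -/
theorem IsPrimitiveRoot.cyclotomic_dvd_of_aeval_eq_zero {R : Type*} [CommRing R] [IsDomain R]
    [CharZero R] {n : ℕ} {ζ : R} (hζ : IsPrimitiveRoot ζ n) (hn : 0 < n) {p : ℤ[X]}
    (hp : aeval ζ p = 0) : cyclotomic n ℤ ∣ p := by
  have hinj := IsFractionRing.injective R (FractionRing R)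
  have : CharZero (FractionRing R) := charZero_of_injective_algebraMap hinj
  refine (hζ.map_of_injective hinj).cyclotomic_dvd_of_eval₂_eq_zero hn ?_
  rw [RingHom.ext_int (Int.castRingHom (FractionRing R))
    ((algebraMap R (FractionRing R)).comp (algebraMap ℤ R)), ← hom_eval₂, ← aeval_def, hp, map_zero]

open Polynomial in
theorem Polynomial.cyclotomic_twelve (R : Type*) [CommRing R] :
    cyclotomic 12 R = X ^ 4 - X ^ 2 + 1 := by
  rw [show 12 = 6 * 2 by norm_num,
    ← cyclotomic_expand_eq_cyclotomic Nat.prime_two (by norm_num), cyclotomic_six]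
  simp only [map_add, map_sub, map_pow, expand_X, map_one]
  ring

open Polynomial in
/-- If `f` divides `p` modulo `n`, then `p` lies in the ideal `(f, n)` of `ℤ[X]`. -/
theorem Polynomial.exists_eq_mul_add_of_map_dvd_map {n : ℕ} {f p : ℤ[X]}
    (h : f.map (Int.castRingHom (ZMod n)) ∣ p.map (Int.castRingHom (ZMod n))) :
    ∃ q r : ℤ[X], p = f * q + C (n : ℤ) * r := by
  obtain ⟨q', hq'⟩ := h
  obtain ⟨q, rfl⟩ := map_surjective _ (ZMod.ringHom_surjective (Int.castRingHom (ZMod n))) q'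
  obtain ⟨r, hr⟩ : C (n : ℤ) ∣ p - f * q := by
    rw [C_dvd_iff_dvd_coeff]
    intro i
    rw [← ZMod.intCast_zmod_eq_zero_iff_dvd, ← eq_intCast (Int.castRingHom (ZMod n)),
      ← coeff_map, Polynomial.map_sub, Polynomial.map_mul, hq', sub_self, coeff_zero]
  exact ⟨q, r, by rw [← hr]; ring⟩

open Polynomial in
theorem irreducible_X_sq_add_two_mul_X_sub_one :
    Irreducible (X ^ 2 + 2 * X - 1 : (ZMod 5)[X]) := by
  have hroot : ∀ x : ZMod 5, x ^ 2 + 2 * x - 1 ≠ 0 := by decide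
  have hdeg : (X ^ 2 + 2 * X - 1 : (ZMod 5)[X]).natDegree = 2 := by compute_degree!
  have : Fact (Nat.Prime 5) := ⟨by norm_num⟩
  refine irreducible_of_degree_le_three_of_not_isRoot (by simp [hdeg]) fun x hx ↦ hroot x ?_
  simpa using hx

open Polynomial in
/-- In `ℤ[ζ]`, `ζ` a primitive 12th root of unity (formalized as: `R` a
characteristic-zero integral domain generated over `ℤ` by a primitive 12th root of unity `ζ`,
so that `R ≅ ℤ[ζ₁₂]`), the ideal generated by `2 + ζ³ = 2 + i` is maximal and the quotient
ring `ℤ[ζ]/(2 + ζ³)` is a finite field with exactly 25 elements. -/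
theorem stmt_13 (R : Type*) [CommRing R] [IsDomain R] [CharZero R] (ζ : R)
    (hζ : IsPrimitiveRoot ζ 12) (hadj : Algebra.adjoin ℤ {ζ} = ⊤) :
    (Ideal.span {(2 + ζ ^ 3 : R)}).IsMaximal ∧
    Nat.card (R ⧸ Ideal.span {(2 + ζ ^ 3 : R)}) = 25 := by
  have : Fact (Nat.Prime 5) := ⟨by norm_num⟩
  let f : (ZMod 5)[X] := X ^ 2 + 2 * X - 1
  have : Fact (Irreducible f) := ⟨irreducible_X_sq_add_two_mul_X_sub_one⟩
  have hdeg : f.natDegree = 2 := by simp only [f]; compute_degree!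
  have hf0 : f ≠ 0 := Fact.out (p := Irreducible f) |>.ne_zero
  let pb := AdjoinRoot.powerBasis hf0
  have : Module.Finite (ZMod 5) (AdjoinRoot f) := pb.finite
  have hcard : Nat.card (AdjoinRoot f) = 25 := by
    rw [Module.natCard_eq_pow_finrank (K := ZMod 5), pb.finrank, AdjoinRoot.powerBasis_dim, hdeg]
    simp
  have hζ4 : ζ ^ 4 - ζ ^ 2 + 1 = 0 := by
    simpa [cyclotomic_twelve, IsRoot] using hζ.isRoot_cyclotomic (by norm_num)
  let ev : ℤ[X] →+* R := (aeval ζ : ℤ[X] →ₐ[ℤ] R).toRingHom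
  have hev : Function.Surjective ev := by
    intro r
    have hr : r ∈ Algebra.adjoin ℤ {ζ} := hadj ▸ Algebra.mem_top
    rwa [Algebra.adjoin_singleton_eq_range_aeval] at hr
  let red : ℤ[X] →+* AdjoinRoot f := (AdjoinRoot.mk f).comp (mapRingHom (Int.castRingHom (ZMod 5)))
  have hred : Function.Surjective red :=
    AdjoinRoot.mk_surjective.comp
      (map_surjective _ (ZMod.ringHom_surjective (Int.castRingHom (ZMod 5))))
  have hred_iff (p : ℤ[X]) : red p = 0 ↔ f ∣ p.map (Int.castRingHom (ZMod 5)) :=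
    AdjoinRoot.mk_eq_zero
  have h5 : (5 : (ZMod 5)[X]) = 0 := CharP.cast_eq_zero (ZMod 5)[X] 5
  have hker : RingHom.ker ev ≤ RingHom.ker red := by
    intro p hp
    refine (hred_iff p).2 (dvd_trans ?_ (Polynomial.map_dvd _
      (hζ.cyclotomic_dvd_of_aeval_eq_zero (by norm_num) hp)))
    rw [map_cyclotomic, cyclotomic_twelve]
    exact ⟨X ^ 2 - 2 * X - 1, by linear_combination (X ^ 2) * h5⟩
  let g : R →+* AdjoinRoot f := ev.liftOfSurjective hev ⟨red, hker⟩
  have hg (p : ℤ[X]) : g (ev p) = red p := ev.liftOfSurjective_comp_apply hev ⟨red, hker⟩ p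
  have hgsurj : Function.Surjective g := fun y ↦ by
    obtain ⟨p, rfl⟩ := hred y
    exact ⟨ev p, hg p⟩
  have hgker : RingHom.ker g = Ideal.span {(2 + ζ ^ 3 : R)} := by
    apply le_antisymm
    · intro r hr
      obtain ⟨p, rfl⟩ := hev r
      rw [RingHom.mem_ker, hg, hred_iff] at hr
      obtain ⟨q, s, rfl⟩ := exists_eq_mul_add_of_map_dvd_map (n := 5)
        (f := X ^ 2 + 2 * X - 1) (by simpa [f] using hr)
      have hevq : ev ((X ^ 2 + 2 * X - 1) * q + C ((5 : ℕ) : ℤ) * s) =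
          (ζ ^ 2 + 2 * ζ - 1) * ev q + 5 * ev s := by
        simp [ev, map_ofNat (aeval ζ)]
      rw [hevq, Ideal.mem_span_singleton]
      exact ⟨ζ * ev q + (2 - ζ ^ 3) * ev s, by
        linear_combination (-ev q + (ζ ^ 2 + 1) * ev s) * hζ4⟩
    · rw [Ideal.span_singleton_le_iff_mem, RingHom.mem_ker,
        show 2 + ζ ^ 3 = ev (2 + X ^ 3) by simp [ev, map_ofNat (aeval ζ)], hg, hred_iff]
      refine ⟨X - 2, ?_⟩
      simp only [Polynomial.map_add, Polynomial.map_pow, map_X, Polynomial.map_ofNat, f]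
      linear_combination X * h5
  rw [← hgker]
  exact ⟨RingHom.ker_isMaximal_of_surjective g hgsurj,
    (Nat.card_congr (RingHom.quotientKerEquivOfSurjective hgsurj).toEquiv).trans hcard⟩
end
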